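/- Let $n>4$ and let $u\in C^4(\mathbb{R}^n)$ satisfy $\Delta^2 u=e^u$ on $\mathbb{R}^n$, be stable outside the ball $B_R$ (in the fourth-order sense), and have $\Delta u(x)\to0$ as $|x|\to\infty$; set $v:=-\Delta u$. Let $\alpha^{\sharp}<\alpha^*$ be the two largest real roots of $X^3-8X+4$ and let $\alpha\in(\alpha^{\sharp},\min\{\frac n4,\alpha^*\})$. If there is a constant $C>0$ such that $\int_{B_{2r}\setminus B_r}\big(e^{\alpha u}+|v|^{2\alpha}\big)\,dx \le C r^{n-4\alpha}$ for all $r\ge 2R$, then there is a constant $C'>0$ such that $\int_{B_{2r}\setminus B_r}\big(e^{\frac{n}{n-2}\alpha u}+|v|^{\frac{2n}{n-2}\alpha}\big)\,dx \le C' r^{\,n-\frac{4n}{n-2}\alpha}$ for all $r\ge 3R$. -/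

import Mathlib

open MeasureTheory Metric Filter Set

noncomputable section

/-- Euclidean space `ℝ^n`. -/
abbrev En (n : ℕ) : Type := EuclideanSpace ℝ (Fin n)

/-- The Laplacian of `f` at `x`: the trace of the Hessian,
`Δ f (x) = ∑ i ∂²f/∂xᵢ² (x)`. -/
def lap {m : ℕ} (f : EuclideanSpace ℝ (Fin m) → ℝ) (x : EuclideanSpace ℝ (Fin m)) : ℝ :=
  ∑ i, fderiv ℝ (fun y => fderiv ℝ f y (EuclideanSpace.single i (1:ℝ))) x
      (EuclideanSpace.single i (1:ℝ))

/-- `φ ∈ C_c^∞(S)`: smooth, compactly supported, with (closed) support contained in `S`. -/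
def TestOn (n : ℕ) (S : Set (En n)) (φ : En n → ℝ) : Prop :=
  ContDiff ℝ (⊤ : ℕ∞) φ ∧ HasCompactSupport φ ∧ tsupport φ ⊆ S

/-- `u` is stable outside the ball `B_R` in the fourth-order sense:
`∫ e^u φ² ≤ ∫ (Δφ)²` for all `φ ∈ C_c^∞(ℝ^n \ closure B_R)`. -/
def Stable4OutsideBall (n : ℕ) (u : En n → ℝ) (R : ℝ) : Prop :=
  ∀ φ : En n → ℝ, TestOn n (Metric.closedBall (0 : En n) R)ᶜ φ →
    ∫ x, Real.exp (u x) * φ x ^ 2 ≤ ∫ x, (lap φ x) ^ 2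

/-- The `i`-th partial derivative. -/
def pd {m : ℕ} (i : Fin m) (f : En m → ℝ) (x : En m) : ℝ :=
  fderiv ℝ f x (EuclideanSpace.single i (1 : ℝ))

/-- The pointwise inner product of the gradients of `f` and `g`. -/
def gam {m : ℕ} (f g : En m → ℝ) (x : En m) : ℝ := ∑ i, pd i f x * pd i g x

section Calculus

variable {m : ℕ} {f g : En m → ℝ}

lemma lap_eq_sum_pd (f : En m → ℝ) (x : En m) : lap f x = ∑ i, pd i (pd i f) x := rfl

lemma contDiff_pd {k : ℕ} (hf : ContDiff ℝ (k + 1 : ℕ) f) (i : Fin m) :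
    ContDiff ℝ k (pd i f) :=
  (hf.fderiv_right (by norm_cast)).clm_apply contDiff_const

lemma contDiff_lap {k : ℕ} (hf : ContDiff ℝ (k + 2 : ℕ) f) : ContDiff ℝ k (lap f) := by
  have : lap f = fun x => ∑ i, pd i (pd i f) x := rfl
  rw [this]
  exact ContDiff.sum fun i _ => contDiff_pd (contDiff_pd (k := k + 1) hf i) i

lemma continuous_pd (hf : ContDiff ℝ 1 f) (i : Fin m) : Continuous (pd i f) :=
  (contDiff_pd (k := 0) (by simpa using hf) i).continuous

lemma contDiff_one_pd (hf : ContDiff ℝ 2 f) (i : Fin m) : ContDiff ℝ 1 (pd i f) := by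
  simpa using contDiff_pd (k := 1) (by simpa using hf) i

lemma continuous_lap (hf : ContDiff ℝ 2 f) : Continuous (lap f) :=
  (contDiff_lap (k := 0) (by simpa using hf)).continuous

lemma continuous_gam (hf : ContDiff ℝ 1 f) (hg : ContDiff ℝ 1 g) : Continuous (gam f g) :=
  continuous_finsetSum _ fun i _ => (continuous_pd hf i).mul (continuous_pd hg i)

lemma pd_eq_zero_of_notMem {x : En m} (hx : x ∉ tsupport f) (i : Fin m) : pd i f x = 0 := by
  have : fderiv ℝ f x = 0 := by
    by_contra h
    exact hx (support_fderiv_subset ℝ h)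
  simp [pd, this]

lemma tsupport_pd_subset (i : Fin m) : tsupport (pd i f) ⊆ tsupport f :=
  closure_minimal (fun _ hx => by_contra fun h => hx (pd_eq_zero_of_notMem h i))
    (isClosed_tsupport f)

lemma lap_eq_zero_of_notMem {x : En m} (hx : x ∉ tsupport f) : lap f x = 0 := by
  rw [lap_eq_sum_pd]
  exact Finset.sum_eq_zero fun i _ =>
    pd_eq_zero_of_notMem (fun h => hx (tsupport_pd_subset i h)) i

lemma gam_eq_zero_of_notMem {x : En m} (hx : x ∉ tsupport f) : gam f g x = 0 :=
  Finset.sum_eq_zero fun i _ => by rw [pd_eq_zero_of_notMem hx i, zero_mul]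

lemma gam_comm (f g : En m → ℝ) (x : En m) : gam f g x = gam g f x :=
  Finset.sum_congr rfl fun _ _ => mul_comm _ _

lemma gam_self_nonneg (f : En m → ℝ) (x : En m) : 0 ≤ gam f f x :=
  Finset.sum_nonneg fun _ _ => mul_self_nonneg _

lemma sq_gam_le (f g : En m → ℝ) (x : En m) : gam f g x ^ 2 ≤ gam f f x * gam g g x := by
  have := Finset.sum_mul_sq_le_sq_mul_sq Finset.univ (fun i => pd i f x) (fun i => pd i g x)
  simpa [gam, sq] using this

lemma pd_add {x : En m} (hf : DifferentiableAt ℝ f x) (hg : DifferentiableAt ℝ g x) (i : Fin m) :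
    pd i (fun y => f y + g y) x = pd i f x + pd i g x := by
  simp only [pd]
  rw [fderiv_fun_add hf hg]
  simp

lemma pd_mul {x : En m} (hf : DifferentiableAt ℝ f x) (hg : DifferentiableAt ℝ g x) (i : Fin m) :
    pd i (fun y => f y * g y) x = f x * pd i g x + g x * pd i f x := by
  simp only [pd]
  rw [fderiv_fun_mul hf hg]
  simp

lemma pd_comp {F : ℝ → ℝ} {F' : ℝ} {x : En m} (hF : HasDerivAt F F' (f x))
    (hf : DifferentiableAt ℝ f x) (i : Fin m) :
    pd i (fun y => F (f y)) x = F' * pd i f x := by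
  have := (hF.comp_hasFDerivAt x hf.hasFDerivAt).fderiv
  simp only [pd]
  change fderiv ℝ (F ∘ f) x _ = _
  rw [this]
  simp

lemma gam_mul_left {h : En m → ℝ} {x : En m} (hf : DifferentiableAt ℝ f x)
    (hg : DifferentiableAt ℝ g x) :
    gam (fun y => f y * g y) h x = f x * gam g h x + g x * gam f h x := by
  simp only [gam, pd_mul hf hg, Finset.mul_sum, ← Finset.sum_add_distrib]
  exact Finset.sum_congr rfl fun _ _ => by ring

lemma gam_comp_left {h : En m → ℝ} {F : ℝ → ℝ} {F' : ℝ} {x : En m} (hF : HasDerivAt F F' (f x))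
    (hf : DifferentiableAt ℝ f x) :
    gam (fun y => F (f y)) h x = F' * gam f h x := by
  simp only [gam, pd_comp hF hf, Finset.mul_sum]
  exact Finset.sum_congr rfl fun _ _ => by ring

lemma lap_mul (hf : ContDiff ℝ 2 f) (hg : ContDiff ℝ 2 g) (x : En m) :
    lap (fun y => f y * g y) x = f x * lap g x + 2 * gam f g x + g x * lap f x := by
  have hfd : Differentiable ℝ f := hf.differentiable (by norm_num)
  have hgd : Differentiable ℝ g := hg.differentiable (by norm_num)
  have h1 : ∀ i, pd i (fun y => f y * g y) = fun y => f y * pd i g y + g y * pd i f y :=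
    fun i => funext fun y => pd_mul (hfd y) (hgd y) i
  have hpf : ∀ i, Differentiable ℝ (pd i f) := fun i =>
    (contDiff_one_pd hf i).differentiable (by norm_num)
  have hpg : ∀ i, Differentiable ℝ (pd i g) := fun i =>
    (contDiff_one_pd hg i).differentiable (by norm_num)
  have h2 : ∀ i, pd i (pd i (fun y => f y * g y)) x
      = (f x * pd i (pd i g) x + pd i g x * pd i f x)
        + (g x * pd i (pd i f) x + pd i f x * pd i g x) := by
    intro i
    rw [h1, pd_add ((hfd x).fun_mul (hpg i x)) ((hgd x).fun_mul (hpf i x)),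
      pd_mul (hfd x) (hpg i x), pd_mul (hgd x) (hpf i x)]
  simp only [lap_eq_sum_pd, h2, gam, Finset.mul_sum, ← Finset.sum_add_distrib]
  exact Finset.sum_congr rfl fun _ _ => by ring

lemma lap_comp {F F' : ℝ → ℝ} {F'' : ℝ} {x : En m} (hf : ContDiff ℝ 2 f)
    (hF : ∀ y, HasDerivAt F (F' (f y)) (f y)) (hF' : HasDerivAt F' F'' (f x)) :
    lap (fun y => F (f y)) x = F' (f x) * lap f x + F'' * gam f f x := by
  have hfd : Differentiable ℝ f := hf.differentiable (by norm_num)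
  have h1 : ∀ i, pd i (fun y => F (f y)) = fun y => F' (f y) * pd i f y :=
    fun i => funext fun y => pd_comp (hF y) (hfd y) i
  have hpf : ∀ i, Differentiable ℝ (pd i f) := fun i =>
    (contDiff_one_pd hf i).differentiable (by norm_num)
  have h2 : ∀ i, pd i (pd i (fun y => F (f y))) x
      = F' (f x) * pd i (pd i f) x + pd i f x * (F'' * pd i f x) := by
    intro i
    rw [h1, pd_mul (f := fun y => F' (f y)) ((hF'.differentiableAt).comp x (hfd x))
      (hpf i x), pd_comp hF' (hfd x)]
  simp only [lap_eq_sum_pd, h2, gam, Finset.mul_sum, ← Finset.sum_add_distrib]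
  exact Finset.sum_congr rfl fun _ _ => by ring

lemma integral_mul_lap (hf : ContDiff ℝ 1 f) (hg : ContDiff ℝ 2 g)
    (h1 : ∀ i, Integrable fun x => f x * pd i g x)
    (h2 : ∀ i, Integrable fun x => pd i f x * pd i g x)
    (h3 : ∀ i, Integrable fun x => f x * pd i (pd i g) x) :
    ∫ x, f x * lap g x = -∫ x, gam f g x := by
  simp only [lap_eq_sum_pd, gam, Finset.mul_sum]
  rw [integral_finsetSum _ fun i _ => h3 i, integral_finsetSum _ fun i _ => h2 i,
    ← Finset.sum_neg_distrib]
  refine Finset.sum_congr rfl fun i _ => ?_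
  exact integral_mul_fderiv_eq_neg_fderiv_mul_of_integrable (h2 i) (h3 i) (h1 i)
    (fun x _ => hf.differentiable (by norm_num) x)
    (fun x _ => (contDiff_one_pd hg i).differentiable (by norm_num) x)

lemma integral_mul_lap_of_hasCompactSupport (hf : ContDiff ℝ 1 f) (hg : ContDiff ℝ 2 g)
    (hc : HasCompactSupport f) :
    ∫ x, f x * lap g x = -∫ x, gam f g x := by
  have hcp : ∀ i, HasCompactSupport (pd i f) := fun i =>
    hc.of_isClosed_subset (isClosed_tsupport _) (tsupport_pd_subset i)
  refine integral_mul_lap hf hg (fun i => ?_) (fun i => ?_) (fun i => ?_)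
  · exact (hf.continuous.mul
      (continuous_pd (hg.of_le (by norm_num)) i)).integrable_of_hasCompactSupport hc.mul_right
  · exact ((continuous_pd hf i).mul
      (continuous_pd (hg.of_le (by norm_num)) i)).integrable_of_hasCompactSupport (hcp i).mul_right
  · exact (hf.continuous.mul
      (continuous_pd (contDiff_one_pd hg i) i)).integrable_of_hasCompactSupport hc.mul_right

/-- A `C²` function has nonnegative Laplacian at a minimum. -/
lemma lap_nonneg_of_isMin (hf : ContDiff ℝ 2 f) {x : En m} (hx : ∀ y, f x ≤ f y) :
    0 ≤ lap f x := by
  rw [lap_eq_sum_pd]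
  refine Finset.sum_nonneg fun i _ => ?_
  by_contra! hneg
  set e : En m := EuclideanSpace.single i (1 : ℝ)
  have hl : ∀ t : ℝ, HasDerivAt (fun s : ℝ => x + s • e) e t := fun t => by
    simpa using ((hasDerivAt_id t).smul_const e).const_add x
  have hcomp : ∀ h : En m → ℝ, Differentiable ℝ h → ∀ t : ℝ,
      HasDerivAt (fun s : ℝ => h (x + s • e)) (pd i h (x + t • e)) t := fun h hh t =>
    (hh _).hasFDerivAt.comp_hasDerivAt t (hl t)
  have hd1 : deriv (fun s : ℝ => f (x + s • e)) = fun t => pd i f (x + t • e) :=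
    funext fun t => (hcomp f (hf.differentiable (by norm_num)) t).deriv
  have hpd := hcomp (pd i f) ((contDiff_one_pd hf i).differentiable (by norm_num))
  have hd2 : deriv (deriv (fun s : ℝ => f (x + s • e))) 0 = pd i (pd i f) x := by
    rw [hd1, (hpd 0).deriv]; simp
  have hmin : IsLocalMin (fun s : ℝ => f (x + s • e)) 0 :=
    Filter.Eventually.of_forall fun s => by simpa using hx (x + s • e)
  have hmax : IsLocalMax (fun s : ℝ => f (x + s • e)) 0 :=
    isLocalMax_of_deriv_deriv_neg (by rw [hd2]; exact hneg) hmin.deriv_eq_zero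
      (hcomp f (hf.differentiable (by norm_num)) 0).continuousAt
  have hconst : (fun s : ℝ => f (x + s • e)) =ᶠ[nhds 0] fun _ => f x := by
    filter_upwards [hmin, hmax] with s h1 h2
    simp only [zero_smul, add_zero] at h1 h2
    exact le_antisymm h2 h1
  have := hconst.deriv.deriv_eq
  rw [hd2] at this
  simp at this
  exact hneg.ne this

/-- A strictly superharmonic function vanishing at infinity is positive. -/
lemma pos_of_lap_neg (hf : ContDiff ℝ 2 f) (hlap : ∀ x, lap f x < 0)
    (h0 : Tendsto f (cocompact (En m)) (nhds 0)) (x : En m) : 0 < f x := by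
  by_contra! hx
  obtain ⟨y, hy⟩ : ∃ y, ∀ z, f y ≤ f z := by
    by_cases h : ∃ z, f z < 0
    · obtain ⟨z, hz⟩ := h
      refine hf.continuous.exists_forall_le' z ?_
      filter_upwards [h0.eventually (lt_mem_nhds hz)] with w hw using hw.le
    · push Not at h
      exact ⟨x, fun z => hx.trans (h z)⟩
  exact (hlap y).not_ge (lap_nonneg_of_isMin hf hy)

end Calculus

section Energy

variable {m : ℕ}

/-- Energy identity for `w η` when `w Δw = -q + κ |∇w|²`. -/
lemma energy_identity {w η q : En m → ℝ} {κ : ℝ} (hw : ContDiff ℝ 2 w) (hη : ContDiff ℝ 2 η)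
    (hc : HasCompactSupport η) (hq : Continuous q)
    (heq : ∀ x, w x * lap w x = -q x + κ * gam w w x) :
    (1 + κ) * ∫ x, gam (fun y => w y * η y) (fun y => w y * η y) x =
      (∫ x, q x * η x ^ 2) + ∫ x, w x ^ 2 * (gam η η x - κ * (η x * lap η x)) := by
  have hw1 : ContDiff ℝ 1 w := hw.of_le (by norm_num)
  have hη1 : ContDiff ℝ 1 η := hη.of_le (by norm_num)
  have dw : Differentiable ℝ w := hw1.differentiable (by norm_num)
  have dη : Differentiable ℝ η := hη1.differentiable (by norm_num)
  have int : ∀ F : En m → ℝ, Continuous F → (∀ x, x ∉ tsupport η → F x = 0) → Integrable F :=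
    fun F hF h0 => hF.integrable_of_hasCompactSupport (HasCompactSupport.intro hc h0)
  have z : ∀ x, x ∉ tsupport η → η x = 0 := fun x hx => image_eq_zero_of_notMem_tsupport hx
  have cw := hw.continuous
  have cη := hη.continuous
  have cww := continuous_gam hw1 hw1
  have cwη := continuous_gam hw1 hη1
  have cηη := continuous_gam hη1 hη1
  have clη := continuous_lap hη
  have iP := int (fun x => η x ^ 2 * gam w w x) (by fun_prop) (fun x hx => by simp [z x hx])
  have iZ := int (fun x => w x * η x * gam w η x) (by fun_prop) (fun x hx => by simp [z x hx])
  have iX := int (fun x => w x ^ 2 * gam η η x) (by fun_prop)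
    (fun x hx => by simp [gam_eq_zero_of_notMem hx])
  have iY := int (fun x => w x ^ 2 * η x * lap η x) (by fun_prop) (fun x hx => by simp [z x hx])
  have iQ := int (fun x => q x * η x ^ 2) (by fun_prop) (fun x hx => by simp [z x hx])
  have hE : ∫ x, gam (fun y => w y * η y) (fun y => w y * η y) x =
      (∫ x, η x ^ 2 * gam w w x) + 2 * (∫ x, w x * η x * gam w η x)
        + ∫ x, w x ^ 2 * gam η η x := by
    rw [← integral_const_mul, ← integral_add iP (iZ.const_mul 2),
      ← integral_add (iP.fun_add (iZ.const_mul 2)) iX]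
    refine integral_congr_ae (Eventually.of_forall fun x => ?_)
    simp only [gam_mul_left (dw x) (dη x)]
    rw [gam_comm η, gam_comm w, gam_mul_left (dw x) (dη x), gam_mul_left (dw x) (dη x),
      gam_comm η w]
    ring
  have h1 := integral_mul_lap_of_hasCompactSupport (f := fun x => (w x * η x) * η x) (g := w)
    ((hw1.mul hη1).mul hη1) hw hc.mul_left
  have h1l : ∫ x, (w x * η x) * η x * lap w x =
      -(∫ x, q x * η x ^ 2) + κ * ∫ x, η x ^ 2 * gam w w x := by
    rw [← integral_const_mul, ← integral_neg, ← integral_add iQ.fun_neg (iP.const_mul κ)]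
    refine integral_congr_ae (Eventually.of_forall fun x => ?_)
    linear_combination η x ^ 2 * heq x
  have h1r : ∫ x, gam (fun x => (w x * η x) * η x) w x =
      (∫ x, η x ^ 2 * gam w w x) + 2 * ∫ x, w x * η x * gam w η x := by
    rw [← integral_const_mul, ← integral_add iP (iZ.const_mul 2)]
    refine integral_congr_ae (Eventually.of_forall fun x => ?_)
    simp only
    rw [gam_mul_left (f := fun x => w x * η x) ((dw x).mul (dη x)) (dη x),
      gam_mul_left (dw x) (dη x), gam_comm η w]
    ring
  have h2 := integral_mul_lap_of_hasCompactSupport (f := fun x => (w x * w x) * η x) (g := η)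
    ((hw1.mul hw1).mul hη1) hη hc.mul_left
  have h2l : ∫ x, (w x * w x) * η x * lap η x = ∫ x, w x ^ 2 * η x * lap η x := by
    simp only [sq]
  have h2r : ∫ x, gam (fun x => (w x * w x) * η x) η x =
      2 * (∫ x, w x * η x * gam w η x) + ∫ x, w x ^ 2 * gam η η x := by
    rw [← integral_const_mul, ← integral_add (iZ.const_mul 2) iX]
    refine integral_congr_ae (Eventually.of_forall fun x => ?_)
    simp only
    rw [gam_mul_left (f := fun x => w x * w x) ((dw x).mul (dw x)) (dη x),
      gam_mul_left (dw x) (dw x)]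
    ring
  have hL : ∫ x, w x ^ 2 * (gam η η x - κ * (η x * lap η x)) =
      (∫ x, w x ^ 2 * gam η η x) - κ * ∫ x, w x ^ 2 * η x * lap η x := by
    rw [← integral_const_mul, ← integral_sub iX (iY.const_mul κ)]
    refine integral_congr_ae (Eventually.of_forall fun x => ?_)
    ring
  rw [h1l, h1r] at h1
  rw [h2l, h2r] at h2
  rw [hE, hL]
  linear_combination h1 + κ * h2

lemma integral_sq_mul_le {w b : En m → ℝ} {S : Set (En m)} {k : ℝ} (hS : IsCompact S)
    (hw : Continuous w) (hb : Continuous b) (hsupp : ∀ x, x ∉ S → b x = 0) (hk : ∀ x, b x ≤ k) :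
    ∫ x, w x ^ 2 * b x ≤ k * ∫ x in S, w x ^ 2 := by
  rw [← setIntegral_eq_integral_of_forall_compl_eq_zero (s := S) (fun x hx => by simp [hsupp x hx]),
    ← integral_const_mul]
  refine setIntegral_mono_on (((hw.pow 2).mul hb).continuousOn.integrableOn_compact hS)
    ((continuous_const.mul (hw.pow 2)).continuousOn.integrableOn_compact hS) hS.measurableSet
    fun x _ => ?_
  rw [mul_comm]
  exact mul_le_mul_of_nonneg_right (hk x) (sq_nonneg _)

lemma energy_le {w η q : En m → ℝ} {κ k : ℝ} {S : Set (En m)} (hw : ContDiff ℝ 2 w)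
    (hη : ContDiff ℝ 2 η) (hS : IsCompact S) (hηS : tsupport η ⊆ S) (hq : Continuous q)
    (heq : ∀ x, w x * lap w x = -q x + κ * gam w w x) (hκ : 0 < 1 + κ)
    (h1 : ∀ x, |η x| ≤ 1) (hg : ∀ x, gam η η x ≤ k) (hl : ∀ x, |lap η x| ≤ k) :
    ∫ x, gam (fun y => w y * η y) (fun y => w y * η y) x ≤
      (1 + κ)⁻¹ * (∫ x, q x * η x ^ 2) + (1 + κ)⁻¹ * (1 + |κ|) * k * ∫ x in S, w x ^ 2 := by
  have h := energy_identity hw hη (hS.of_isClosed_subset (isClosed_tsupport η) hηS) hq heq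
  have hη1 : ContDiff ℝ 1 η := hη.of_le (by norm_num)
  have h2 := integral_sq_mul_le (b := fun x => gam η η x - κ * (η x * lap η x))
    (k := (1 + |κ|) * k) hS hw.continuous
    (by have := continuous_gam hη1 hη1; have := continuous_lap hη; have := hη.continuous; fun_prop)
    (fun x hx => by
      have hx' : x ∉ tsupport η := fun h => hx (hηS h)
      simp [gam_eq_zero_of_notMem hx', lap_eq_zero_of_notMem hx'])
    (fun x => by
      have hk : 0 ≤ k := (abs_nonneg _).trans (hl x)
      have : |κ * (η x * lap η x)| ≤ |κ| * k := by
        rw [abs_mul, abs_mul]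
        exact mul_le_mul_of_nonneg_left ((mul_le_of_le_one_left (abs_nonneg _) (h1 x)).trans (hl x))
          (abs_nonneg _)
      have := (abs_le.1 this).1
      have := hg x
      linarith)
  have h3 : ∫ x, gam (fun y => w y * η y) (fun y => w y * η y) x =
      (1 + κ)⁻¹ * ((∫ x, q x * η x ^ 2)
        + ∫ x, w x ^ 2 * (gam η η x - κ * (η x * lap η x))) := by
    rw [← h]; field_simp
  rw [h3, mul_add]
  have := mul_le_mul_of_nonneg_left h2 (inv_pos.2 hκ).le
  linarith

lemma rpow_sub_one_mul_add_le {p X Y : ℝ} (hp : 1 ≤ p) (hX : 0 < X) (hY : 0 < Y) :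
    X ^ (p - 1) * Y + X * Y ^ (p - 1) ≤ X ^ p + Y ^ p := by
  have hXp : X ^ p = X ^ (p - 1) * X := by
    rw [← Real.rpow_add_one hX.ne']; ring_nf
  have hYp : Y ^ p = Y ^ (p - 1) * Y := by
    rw [← Real.rpow_add_one hY.ne']; ring_nf
  rw [hXp, hYp]
  rcases le_total X Y with h | h
  · nlinarith [Real.rpow_le_rpow hX.le h (by linarith : 0 ≤ p - 1)]
  · nlinarith [Real.rpow_le_rpow hY.le h (by linarith : 0 ≤ p - 1)]

lemma weighted_rpow_le {p q β μ ρ v : ℝ} (hp : 1 ≤ p) (hq : 0 < q) (hμ : 0 < μ)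
    (hqβ : q * β = μ ^ 2) (hρ : 0 < ρ) (hv : 0 < v) :
    q * (ρ ^ (p - 1) * v) + (μ / q) ^ (-p) * (β * (ρ * v ^ (p - 1))) ≤
      μ * (ρ ^ p + (μ / q) ^ (-p) * v ^ p) := by
  set s := μ / q with hs
  have hs0 : 0 < s := div_pos hμ hq
  have hV := rpow_sub_one_mul_add_le hp hρ (div_pos hv hs0)
  rw [Real.div_rpow hv.le hs0.le, Real.div_rpow hv.le hs0.le, Real.rpow_sub_one hs0.ne'] at hV
  rw [Real.rpow_neg hs0.le]
  have hsp : 0 < s ^ p := Real.rpow_pos_of_pos hs0 p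
  have e1 : μ * (ρ ^ (p - 1) * (v / s)) = q * (ρ ^ (p - 1) * v) := by
    rw [hs]; field_simp
  have e2 : μ * (ρ * (v ^ (p - 1) / (s ^ p / s))) = (s ^ p)⁻¹ * (β * (ρ * v ^ (p - 1))) := by
    have : μ * s = β := by rw [hs]; field_simp; linarith
    rw [← this]; field_simp
  have e3 : (s ^ p)⁻¹ * v ^ p = v ^ p / s ^ p := by field_simp
  rw [← e1, ← e2, e3, ← mul_add]
  exact mul_le_mul_of_nonneg_left hV hμ.le

end Energy

section Heinz

open scoped InnerProductSpace

/-- Cauchy–Schwarz for the semi-inner product `⟪x, G y⟫` of a nonnegative symmetric operator. -/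
lemma sq_inner_le_of_nonneg {H : Type*} [NormedAddCommGroup H] [InnerProductSpace ℝ H]
    {G : H →ₗ[ℝ] H} (hG : ∀ x y, ⟪x, G y⟫_ℝ = ⟪G x, y⟫_ℝ) (hpos : ∀ x, 0 ≤ ⟪x, G x⟫_ℝ) (x y : H) :
    ⟪x, G y⟫_ℝ ^ 2 ≤ ⟪x, G x⟫_ℝ * ⟪y, G y⟫_ℝ := by
  have h : ∀ t : ℝ, 0 ≤ ⟪x, G x⟫_ℝ * (t * t) + (2 * ⟪x, G y⟫_ℝ) * t + ⟪y, G y⟫_ℝ := fun t => by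
    have := hpos (t • x + y)
    simp only [map_add, map_smul, inner_add_left, inner_add_right, real_inner_smul_left,
      real_inner_smul_right] at this
    have h2 : ⟪y, G x⟫_ℝ = ⟪x, G y⟫_ℝ := by rw [hG y x, real_inner_comm]
    rw [h2] at this
    linarith
  have := discrim_le_zero h
  rw [discrim] at this
  linarith

/-- A form of the Heinz inequality: if `‖B G f‖ ≤ ‖f‖` with `B`, `G` symmetric and `G`
nonnegative, then `⟪B φ, φ⟫ ≤ ⟪G⁻¹ φ, φ⟫` on the range of `G`. -/
lemma inner_le_of_norm_comp_le {H : Type*} [NormedAddCommGroup H] [InnerProductSpace ℝ H]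
    {G B : H →ₗ[ℝ] H} (hG : ∀ x y, ⟪x, G y⟫_ℝ = ⟪G x, y⟫_ℝ) (hpos : ∀ x, 0 ≤ ⟪x, G x⟫_ℝ)
    (hB : ∀ x y, ⟪x, B y⟫_ℝ = ⟪B x, y⟫_ℝ) (hc : ∀ x, ‖B (G x)‖ ≤ ‖x‖) (f : H) :
    ⟪B (G f), G f⟫_ℝ ≤ ⟪f, G f⟫_ℝ := by
  set T : H → H := fun x => B (G x) with hT
  have hsymm : ∀ x y, ⟪T x, G y⟫_ℝ = ⟪x, G (T y)⟫_ℝ := fun x y => by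
    simp only [hT]; rw [← hB, ← hG]
  have hit : ∀ k x y, ⟪T^[k] x, G y⟫_ℝ = ⟪x, G (T^[k] y)⟫_ℝ := by
    intro k
    induction k with
    | zero => intro x y; rfl
    | succ k ih => intro x y; rw [Function.iterate_succ_apply, ih, hsymm,
        ← Function.iterate_succ_apply' T]
  have hnorm : ∀ k, ‖T^[k] f‖ ≤ ‖f‖ := by
    intro k
    induction k with
    | zero => rfl
    | succ k ih => rw [Function.iterate_succ_apply']; exact (hc _).trans ih
  set a : ℕ → ℝ := fun k => ⟪T^[k] f, G f⟫_ℝ with ha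
  have hCS : ∀ k, a k ^ 2 ≤ a (2 * k) * a 0 := fun k => by
    have h1 := sq_inner_le_of_nonneg hG hpos (T^[k] f) f
    have h2 : ⟪T^[k] f, G (T^[k] f)⟫_ℝ = a (2 * k) := by
      rw [← hit, ← Function.iterate_add_apply, ← two_mul]
    rwa [h2] at h1
  have hM : ∀ k, a k ≤ ‖f‖ * ‖G f‖ := fun k =>
    (real_inner_le_norm _ _).trans (mul_le_mul_of_nonneg_right (hnorm k) (norm_nonneg _))
  change a 1 ≤ a 0
  by_contra! hlt
  have ha0 : 0 ≤ a 0 := hpos f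
  clear_value a
  rcases ha0.eq_or_lt with h0 | h0
  · have := hCS 1
    rw [← h0, mul_zero] at this
    nlinarith
  · have key : ∀ j : ℕ, a 0 * (1 + 2 ^ j * (a 1 / a 0 - 1)) ≤ a (2 ^ j) := by
      intro j
      have ht : 0 < a 1 / a 0 - 1 := by rw [sub_pos, one_lt_div h0]; exact hlt
      induction j with
      | zero => simp only [pow_zero, one_mul, add_sub_cancel]; rw [mul_div_cancel₀ _ h0.ne']
      | succ j ih =>
        have h1 := hCS (2 ^ j)
        rw [← pow_succ'] at h1
        set t := (2 : ℝ) ^ j * (a 1 / a 0 - 1) with hteq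
        have ht0 : 0 < t := by positivity
        have h2 : (a 0 * (1 + t)) ^ 2 ≤ a (2 ^ (j + 1)) * a 0 :=
          (pow_le_pow_left₀ (by positivity) ih 2).trans h1
        have h3 : (2 : ℝ) ^ (j + 1) * (a 1 / a 0 - 1) = 2 * t := by rw [hteq]; ring
        rw [h3]
        refine le_of_mul_le_mul_right ?_ h0
        nlinarith [mul_pos h0 h0, sq_nonneg (a 0 * t)]
    have hd : 0 < a 1 / a 0 - 1 := by rw [sub_pos, one_lt_div h0]; exact hlt
    obtain ⟨j, hj⟩ := pow_unbounded_of_one_lt (‖f‖ * ‖G f‖ / (a 0 * (a 1 / a 0 - 1))) one_lt_two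
    rw [div_lt_iff₀ (by positivity)] at hj
    have := (key j).trans (hM _)
    nlinarith

end Heinz

section Resolvent

open scoped SchwartzMap Laplacian LineDeriv FourierTransform

variable {m : ℕ}

lemma lap_eq_laplacian {f : En m → ℝ} (hf : ContDiff ℝ 2 f) (x : En m) : lap f x = Δ f x := by
  rw [InnerProductSpace.laplacian_eq_iteratedFDeriv_orthonormalBasis f
    (EuclideanSpace.basisFun (Fin m) ℝ)]
  have hd : DifferentiableAt ℝ (fderiv ℝ f) x :=
    (hf.fderiv_right (m := 1) (by norm_num)).differentiable (by norm_num) x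
  refine Finset.sum_congr rfl fun i _ => ?_
  rw [iteratedFDeriv_two_apply, fderiv_clm_apply hd (by fun_prop)]
  simp

lemma hasTemperateGrowth_inv_add_norm_sq {a c : ℝ} (ha : 0 < a) (hc : 0 < c) :
    (fun x : En m => (c + a * ‖x‖ ^ 2)⁻¹).HasTemperateGrowth := by
  have h : (fun x : En m => (c + a * ‖x‖ ^ 2)⁻¹) =
      fun x : En m => c⁻¹ * (fun y : En m => (1 + ‖y‖ ^ 2) ^ (-1 : ℝ))
        ((√(a / c) • ContinuousLinearMap.id ℝ (En m)) x) := by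
    funext x
    simp only [_root_.smul_apply, ContinuousLinearMap.id_apply, norm_smul,
      Real.norm_of_nonneg (Real.sqrt_nonneg _), mul_pow, Real.sq_sqrt (div_pos ha hc).le,
      Real.rpow_neg_one]
    rw [← mul_inv]
    congr 1
    field_simp
  rw [h]
  have h1 := (Function.hasTemperateGrowth_one_add_norm_sq_rpow (En m) (-1)).comp
    (√(a / c) • ContinuousLinearMap.id ℝ (En m)).hasTemperateGrowth
  exact (Function.HasTemperateGrowth.const _).mul h1

/-- The equation `-aΔφ + cφ = f` is linearly solvable in the real Schwartz space. -/
lemma exists_schwartz_resolvent (m : ℕ) {a c : ℝ} (ha : 0 < a) (hc : 0 < c) :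
    ∃ T : 𝓢(En m, ℝ) →ₗ[ℝ] 𝓢(En m, ℝ), ∀ f x, -a * lap (T f) x + c * T f x = f x := by
  set k : ℝ := a * (2 * Real.pi) ^ 2 with hk
  have hk0 : 0 < k := by positivity
  set σ : En m → ℝ := fun x => (c + k * ‖x‖ ^ 2)⁻¹ with hσ
  have hσt : σ.HasTemperateGrowth := hasTemperateGrowth_inv_add_norm_sq hk0 hc
  let T : 𝓢(En m, ℝ) →ₗ[ℝ] 𝓢(En m, ℝ) :=
    (SchwartzMap.postcompCLM Complex.reCLM ∘L SchwartzMap.fourierMultiplierCLM ℂ σ ∘L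
      SchwartzMap.postcompCLM Complex.ofRealCLM).toLinearMap
  refine ⟨T, fun f x => ?_⟩
  set F : 𝓢(En m, ℂ) := SchwartzMap.postcompCLM Complex.ofRealCLM f with hF
  set Φ : 𝓢(En m, ℂ) := SchwartzMap.fourierMultiplierCLM ℂ σ F with hΦ
  have hTf : (T f : En m → ℝ) = Complex.reCLM ∘ (Φ : En m → ℂ) := rfl
  have hΔ : Δ Φ = -(2 * Real.pi) ^ 2 • SchwartzMap.fourierMultiplierCLM ℂ ((‖·‖ ^ 2) * σ) F := by
    rw [SchwartzMap.laplacian_eq_fourierMultiplierCLM, hΦ,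
      SchwartzMap.fourierMultiplierCLM_fourierMultiplierCLM_apply (by fun_prop) hσt]
  have hsum : -a • Δ Φ + c • Φ = F := by
    have hsq : (((‖·‖ ^ 2) * σ : En m → ℝ)).HasTemperateGrowth :=
      Function.HasTemperateGrowth.mul (by fun_prop) hσt
    have hX : k • SchwartzMap.smulLeftCLM ℂ ((‖·‖ ^ 2) * σ : En m → ℝ) (𝓕 F) +
        c • SchwartzMap.smulLeftCLM ℂ σ (𝓕 F) = 𝓕 F := by
      ext y
      simp only [_root_.add_apply, _root_.smul_apply,
        SchwartzMap.smulLeftCLM_apply_apply hsq, SchwartzMap.smulLeftCLM_apply_apply hσt,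
        smul_smul, ← add_smul, Pi.mul_apply]
      simp only [hσ]
      have hy : 0 < c + k * ‖y‖ ^ 2 := by positivity
      have : k * (‖y‖ ^ 2 * (c + k * ‖y‖ ^ 2)⁻¹) + c * (c + k * ‖y‖ ^ 2)⁻¹ = 1 := by
        field_simp
        ring
      rw [this, one_smul]
    have h3 := congrArg (fun G : 𝓢(En m, ℂ) => 𝓕⁻ G) hX
    simp only [FourierTransform.fourierInv_fourier_eq, FourierTransform.fourierInv_add,
      FourierTransform.fourierInv_smul] at h3
    refine Eq.trans ?_ h3
    rw [hΔ, smul_smul, hΦ, SchwartzMap.fourierMultiplierCLM_apply,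
      SchwartzMap.fourierMultiplierCLM_apply, hk, neg_mul_neg]
  have h1 : lap (T f) x = (Δ Φ x).re := by
    rw [lap_eq_laplacian ((T f).smooth 2), hTf, SchwartzMap.laplacian_apply]
    exact ((Φ.smooth 2).contDiffAt).laplacian_CLM_comp_left
  have h2 := congrArg (fun G : 𝓢(En m, ℂ) => (G x).re) hsum
  rw [h1, hTf]
  simpa [hF] using h2

end Resolvent

section Interpolation

open scoped SchwartzMap LineDeriv InnerProductSpace

lemma inner_eq_integral_of_ae_eq {X : Type*} [MeasurableSpace X] {μ : Measure X}
    {F G : Lp ℝ 2 μ} {f g : X → ℝ} (hF : F =ᵐ[μ] f) (hG : G =ᵐ[μ] g) :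
    ⟪F, G⟫_ℝ = ∫ x, f x * g x ∂μ := by
  rw [L2.inner_def]
  refine integral_congr_ae ?_
  filter_upwards [hF, hG] with x hx hy
  rw [hx, hy]
  simp [mul_comm]

/-- Multiplication by a bounded measurable function on `L²`, as a symmetric bounded operator. -/
lemma exists_mul_operator {X : Type*} [MeasurableSpace X] {μ : Measure X} {W : X → ℝ} {M : ℝ}
    (hW : AEStronglyMeasurable W μ) (hM : ∀ x, |W x| ≤ M) :
    ∃ B : Lp ℝ 2 μ →L[ℝ] Lp ℝ 2 μ, ∀ F, B F =ᵐ[μ] fun x => W x * F x := by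
  have hb : ∀ F : Lp ℝ 2 μ, ∀ᵐ x ∂μ, ‖W x * F x‖ ≤ M * ‖F x‖ := fun F =>
    ae_of_all _ fun x => by
      rw [norm_mul]
      exact mul_le_mul_of_nonneg_right (hM x) (norm_nonneg _)
  have hmem : ∀ F : Lp ℝ 2 μ, MemLp (fun x => W x * F x) 2 μ := fun F =>
    (Lp.memLp F).of_le_mul (hW.mul (Lp.memLp F).1) (hb F)
  let B₀ : Lp ℝ 2 μ →ₗ[ℝ] Lp ℝ 2 μ :=
    { toFun := fun F => (hmem F).toLp
      map_add' := fun F G => by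
        refine Lp.ext ?_
        filter_upwards [(hmem (F + G)).coeFn_toLp, (hmem F).coeFn_toLp, (hmem G).coeFn_toLp,
          Lp.coeFn_add F G, Lp.coeFn_add (hmem F).toLp (hmem G).toLp] with x h1 h2 h3 h4 h5
        rw [h1, h5, Pi.add_apply, h2, h3, h4, Pi.add_apply, mul_add]
      map_smul' := fun t F => by
        refine Lp.ext ?_
        filter_upwards [(hmem (t • F)).coeFn_toLp, (hmem F).coeFn_toLp,
          Lp.coeFn_smul t F, Lp.coeFn_smul t (hmem F).toLp] with x h1 h2 h4 h5
        rw [RingHom.id_apply, h1, h5, Pi.smul_apply, h2, h4, Pi.smul_apply, smul_eq_mul,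
          smul_eq_mul]
        ring }
  refine ⟨B₀.mkContinuous M fun F => Lp.norm_le_mul_norm_of_ae_le_mul ?_, fun F =>
    (hmem F).coeFn_toLp⟩
  filter_upwards [(hmem F).coeFn_toLp, hb F] with x h1 h2
  change ‖(hmem F).toLp _ x‖ ≤ _
  rwa [h1]

variable {m : ℕ}

lemma schwartz_pd_eq (f : 𝓢(En m, ℝ)) (i : Fin m) :
    pd i f = (∂_{(EuclideanSpace.single i (1 : ℝ) : En m)} f : 𝓢(En m, ℝ)) := by
  funext x
  rw [SchwartzMap.lineDerivOp_apply_eq_fderiv]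
  rfl

lemma schwartz_lap_eq (f : 𝓢(En m, ℝ)) : lap f = (Laplacian.laplacian f : 𝓢(En m, ℝ)) := by
  funext x
  rw [SchwartzMap.laplacian_apply, lap_eq_laplacian (f.smooth 2)]

lemma schwartz_integrable_mul (f g : 𝓢(En m, ℝ)) : Integrable fun x => f x * g x :=
  (f.memLp 2).integrable_mul (g.memLp 2)

lemma schwartz_integrable_gam (f g : 𝓢(En m, ℝ)) : Integrable (gam f g) := by
  refine integrable_finsetSum _ fun i _ => ?_
  rw [schwartz_pd_eq, schwartz_pd_eq]
  exact schwartz_integrable_mul _ _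

lemma schwartz_integral_mul_lap (f g : 𝓢(En m, ℝ)) :
    ∫ x, f x * lap g x = -∫ x, gam f g x := by
  refine integral_mul_lap (f.smooth 1) (g.smooth 2) (fun i => ?_) (fun i => ?_) fun i => ?_ <;>
    simp only [schwartz_pd_eq] <;> exact schwartz_integrable_mul _ _

lemma integral_mul_resolvent {a c : ℝ} {f g : En m → ℝ} (h1 : Integrable fun x => f x * lap g x)
    (h2 : Integrable fun x => f x * g x) (h : ∫ x, f x * lap g x = -∫ x, gam f g x) :
    ∫ x, f x * (-a * lap g x + c * g x) = a * (∫ x, gam f g x) + c * ∫ x, f x * g x := by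
  have h3 : ∀ x, f x * (-a * lap g x + c * g x) = -a * (f x * lap g x) + c * (f x * g x) :=
    fun x => by ring
  simp only [h3]
  rw [integral_add (h1.const_mul _) (h2.const_mul _), integral_const_mul, integral_const_mul, h]
  ring

lemma schwartz_integral_mul_resolvent {a c : ℝ} (f g : 𝓢(En m, ℝ)) :
    ∫ x, f x * (-a * lap g x + c * g x) = a * (∫ x, gam f g x) + c * ∫ x, f x * g x :=
  integral_mul_resolvent (by rw [schwartz_lap_eq]; exact schwartz_integrable_mul _ _)
    (schwartz_integrable_mul f g) (schwartz_integral_mul_lap f g)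

lemma integral_mul_resolvent_of_hasCompactSupport {a c : ℝ} {f g : En m → ℝ}
    (hf : ContDiff ℝ 1 f) (hg : ContDiff ℝ 2 g) (hc : HasCompactSupport f) :
    ∫ x, f x * (-a * lap g x + c * g x) = a * (∫ x, gam f g x) + c * ∫ x, f x * g x :=
  integral_mul_resolvent
    ((hf.continuous.mul (continuous_lap hg)).integrable_of_hasCompactSupport hc.mul_right)
    ((hf.continuous.mul hg.continuous).integrable_of_hasCompactSupport hc.mul_right)
    (integral_mul_lap_of_hasCompactSupport hf hg hc)

lemma integral_mul_lap_of_hasCompactSupport_right {f g : En m → ℝ}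
    (hf : ContDiff ℝ 1 f) (hg : ContDiff ℝ 2 g) (hc : HasCompactSupport g) :
    ∫ x, f x * lap g x = -∫ x, gam f g x := by
  have hcp : ∀ (h : En m → ℝ) (i), HasCompactSupport h → HasCompactSupport (pd i h) :=
    fun h i hh => hh.of_isClosed_subset (isClosed_tsupport _) (tsupport_pd_subset i)
  have hg1 : ContDiff ℝ 1 g := hg.of_le (by norm_num)
  refine integral_mul_lap hf hg (fun i => ?_) (fun i => ?_) (fun i => ?_)
  · exact (hf.continuous.mul (continuous_pd hg1 i)).integrable_of_hasCompactSupport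
      (hcp g i hc).mul_left
  · exact ((continuous_pd hf i).mul (continuous_pd hg1 i)).integrable_of_hasCompactSupport
      (hcp g i hc).mul_left
  · exact (hf.continuous.mul
      (continuous_pd (contDiff_one_pd hg i) i)).integrable_of_hasCompactSupport
      (hcp _ i (hcp g i hc)).mul_left

lemma hasCompactSupport_lap {f : En m → ℝ} (hc : HasCompactSupport f) :
    HasCompactSupport (lap f) :=
  hc.of_isClosed_subset (isClosed_tsupport _) (closure_minimal
    (fun _ hx => by_contra fun h => hx (lap_eq_zero_of_notMem h)) (isClosed_tsupport f))

lemma integral_mul_resolvent_of_hasCompactSupport_right {a c : ℝ} {f g : En m → ℝ}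
    (hf : ContDiff ℝ 1 f) (hg : ContDiff ℝ 2 g) (hc : HasCompactSupport g) :
    ∫ x, f x * (-a * lap g x + c * g x) = a * (∫ x, gam f g x) + c * ∫ x, f x * g x :=
  integral_mul_resolvent
    ((hf.continuous.mul (continuous_lap hg)).integrable_of_hasCompactSupport
      (hasCompactSupport_lap hc).mul_left)
    ((hf.continuous.mul hg.continuous).integrable_of_hasCompactSupport hc.mul_left)
    (integral_mul_lap_of_hasCompactSupport_right hf hg hc)

/-- A bound for the multiplication by `W²` with respect to the square of `-aΔ + c` interpolates to
a bound for the multiplication by `W` with respect to `-aΔ + c`. -/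
lemma integral_mul_sq_le_of_resolvent {W : En m → ℝ} {M a c : ℝ} (hW : Continuous W)
    (hM : ∀ x, |W x| ≤ M) (ha : 0 < a) (hc : 0 < c)
    (hWφ : ∀ φ : 𝓢(En m, ℝ),
      ∫ x, (W x * φ x) ^ 2 ≤ ∫ x, (-a * lap φ x + c * φ x) ^ 2)
    {ψ : En m → ℝ} (hψ : ContDiff ℝ 2 ψ) (hψc : HasCompactSupport ψ) :
    ∫ x, W x * ψ x ^ 2 ≤ a * (∫ x, gam ψ ψ x) + c * ∫ x, ψ x ^ 2 := by
  obtain ⟨T, hT⟩ := exists_schwartz_resolvent m ha hc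
  obtain ⟨B, hB⟩ := exists_mul_operator (μ := (volume : Measure (En m)))
    hW.aestronglyMeasurable hM
  let e : 𝓢(En m, ℝ) →ₗ[ℝ] Lp ℝ 2 (volume : Measure (En m)) :=
    (SchwartzMap.toLpCLM ℝ ℝ 2 volume).toLinearMap
  have he : ∀ f, (e f : En m → ℝ) =ᵐ[volume] f := fun f => SchwartzMap.coeFn_toLp f 2
  have hd : DenseRange e := SchwartzMap.denseRange_toLpCLM (by norm_num)
  have hinner : ∀ f g : 𝓢(En m, ℝ), ⟪e f, e (T g)⟫_ℝ =
      a * (∫ x, gam (T f) (T g) x) + c * ∫ x, T f x * T g x := fun f g => by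
    rw [inner_eq_integral_of_ae_eq (he f) (he (T g))]
    simp only [← hT f]
    rw [show (∫ x, gam (T f) (T g) x) = ∫ x, gam (T g) (T f) x from
        integral_congr_ae (ae_of_all _ fun x => gam_comm _ _ _),
      show (∫ x, T f x * T g x) = ∫ x, T g x * T f x from
        integral_congr_ae (ae_of_all _ fun x => mul_comm _ _),
      ← schwartz_integral_mul_resolvent]
    exact integral_congr_ae (ae_of_all _ fun x => mul_comm _ _)
  have hTle : ∀ f, ‖(e ∘ₗ T) f‖ ≤ c⁻¹ * ‖e f‖ := fun f => by
    have h1 : c * ‖e (T f)‖ ^ 2 ≤ ⟪e f, e (T f)⟫_ℝ := by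
      rw [hinner, ← real_inner_self_eq_norm_sq,
        inner_eq_integral_of_ae_eq (he (T f)) (he (T f))]
      have : 0 ≤ a * ∫ x, gam (T f) (T f) x :=
        mul_nonneg ha.le (integral_nonneg fun x => gam_self_nonneg _ _)
      linarith
    have h2 := h1.trans (real_inner_le_norm _ _)
    rw [LinearMap.comp_apply, inv_mul_eq_div, le_div_iff₀ hc]
    rcases (norm_nonneg (e (T f))).eq_or_lt with h0 | h0
    · rw [← h0, zero_mul]; positivity
    · nlinarith
  set G := (e ∘ₗ T).extendOfNorm e with hGdef
  have hGe : ∀ f, G (e f) = e (T f) := fun f => LinearMap.extendOfNorm_eq hd ⟨c⁻¹, hTle⟩ f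
  have hGsymm : ∀ x y, ⟪x, G y⟫_ℝ = ⟪G x, y⟫_ℝ := fun x y => by
    refine hd.induction_on₂ (p := fun x y => ⟪x, G y⟫_ℝ = ⟪G x, y⟫_ℝ)
      (isClosed_eq (by fun_prop) (by fun_prop)) (fun f g => ?_) x y
    rw [hGe, hGe, real_inner_comm (e g), hinner, hinner]
    simp only [gam_comm (T f), mul_comm (T f _)]
  have hGpos : ∀ x, 0 ≤ ⟪x, G x⟫_ℝ := fun x => by
    refine hd.induction_on (p := fun x => 0 ≤ ⟪x, G x⟫_ℝ) x
      (isClosed_le (by fun_prop) (by fun_prop)) fun f => ?_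
    rw [hGe, hinner]
    exact add_nonneg (mul_nonneg ha.le (integral_nonneg fun x => gam_self_nonneg _ _))
      (mul_nonneg hc.le (integral_nonneg fun x => mul_self_nonneg _))
  have hBsymm : ∀ x y, ⟪x, B y⟫_ℝ = ⟪B x, y⟫_ℝ := fun x y => by
    rw [inner_eq_integral_of_ae_eq (ae_eq_refl x) (hB y),
      inner_eq_integral_of_ae_eq (hB x) (ae_eq_refl y)]
    exact integral_congr_ae (ae_of_all _ fun _ => by ring)
  have hBG : ∀ x, ‖B (G x)‖ ≤ ‖x‖ := fun x => by
    refine hd.induction_on (p := fun x => ‖B (G x)‖ ≤ ‖x‖) x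
      (isClosed_le (by fun_prop) (by fun_prop)) fun f => ?_
    refine (sq_le_sq₀ (norm_nonneg _) (norm_nonneg _)).1 ?_
    have hBT : B (e (T f)) =ᵐ[volume] fun x => W x * T f x := by
      filter_upwards [hB (e (T f)), he (T f)] with x h1 h2
      rw [h1, h2]
    rw [hGe, ← real_inner_self_eq_norm_sq, ← real_inner_self_eq_norm_sq,
      inner_eq_integral_of_ae_eq hBT hBT, inner_eq_integral_of_ae_eq (he f) (he f)]
    simpa only [← sq, hT] using hWφ (T f)
  have hAmem : MemLp (fun x => -a * lap ψ x + c * ψ x) 2 volume :=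
    (((continuous_lap hψ).const_mul (-a)).add
      (hψ.continuous.const_mul c)).memLp_of_hasCompactSupport
      ((hasCompactSupport_lap hψc).mul_left.add hψc.mul_left)
  have hψmem : MemLp ψ 2 volume := hψ.continuous.memLp_of_hasCompactSupport hψc
  have hGA : G hAmem.toLp = hψmem.toLp := by
    refine hd.eq_of_inner_left ℝ fun g => ?_
    rw [← hGsymm, hGe, inner_eq_integral_of_ae_eq hAmem.coeFn_toLp (he (T g)),
      inner_eq_integral_of_ae_eq hψmem.coeFn_toLp (he g)]
    have h1 := integral_mul_resolvent_of_hasCompactSupport_right (a := a) (c := c)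
      ((T g).smooth 1) hψ hψc
    have h2 := integral_mul_resolvent_of_hasCompactSupport (a := a) (c := c)
      (hψ.of_le (by norm_num)) ((T g).smooth 2) hψc
    simp only [hT g] at h2
    rw [h2]
    simp only [gam_comm ψ, mul_comm (ψ _)]
    rw [← h1]
    exact integral_congr_ae (ae_of_all _ fun _ => mul_comm _ _)
  have hBψ : B hψmem.toLp =ᵐ[volume] fun x => W x * ψ x := by
    filter_upwards [hB hψmem.toLp, hψmem.coeFn_toLp] with x h1 h2
    rw [h1, h2]
  have h := inner_le_of_norm_comp_le (G := G.toLinearMap) (B := B.toLinearMap)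
    hGsymm hGpos hBsymm hBG hAmem.toLp
  simp only [ContinuousLinearMap.coe_coe, hGA] at h
  rw [inner_eq_integral_of_ae_eq hBψ hψmem.coeFn_toLp,
    inner_eq_integral_of_ae_eq hAmem.coeFn_toLp hψmem.coeFn_toLp] at h
  have h1 := integral_mul_resolvent_of_hasCompactSupport (a := a) (c := c)
    (hψ.of_le (by norm_num)) hψ hψc
  simp only [sq]
  rw [← h1]
  refine le_trans (le_of_eq ?_) (h.trans_eq ?_) <;>
    exact integral_congr_ae (ae_of_all _ fun x => by ring)

end Interpolation

section Cutoff

variable {m : ℕ}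

lemma pd_const_mul {f : En m → ℝ} {x : En m} (hf : DifferentiableAt ℝ f x) (s : ℝ) (i : Fin m) :
    pd i (fun y => s * f y) x = s * pd i f x := by
  simp only [pd]
  rw [fderiv_const_mul hf]
  simp

lemma pd_comp_smul (f : En m → ℝ) (s : ℝ) (i : Fin m) :
    pd i (fun x => f (s • x)) = fun x => s * pd i f (s • x) := by
  funext x
  simp only [pd]
  rw [fderiv_comp_smul]
  simp

lemma gam_comp_smul (f : En m → ℝ) (s : ℝ) (x : En m) :
    gam (fun y => f (s • y)) (fun y => f (s • y)) x = s ^ 2 * gam f f (s • x) := by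
  simp only [gam, pd_comp_smul, Finset.mul_sum]
  exact Finset.sum_congr rfl fun _ _ => by ring

lemma lap_comp_smul {f : En m → ℝ} (hf : ContDiff ℝ 2 f) (s : ℝ) (x : En m) :
    lap (fun y => f (s • y)) x = s ^ 2 * lap f (s • x) := by
  simp only [lap_eq_sum_pd, Finset.mul_sum]
  refine Finset.sum_congr rfl fun i _ => ?_
  have hd : Differentiable ℝ (pd i f) := (contDiff_one_pd hf i).differentiable (by norm_num)
  have h1 := pd_const_mul (f := fun y => pd i f (s • y)) (x := x)
    ((hd.comp (differentiable_id.const_smul s)) x) s i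
  rw [pd_comp_smul f s i, h1, pd_comp_smul (pd i f) s i]
  ring

/-- A smooth cutoff equal to `1` on the annulus `b ≤ |x| ≤ c` and supported in `a ≤ |x| ≤ d`. -/
lemma exists_annulus_cutoff (m : ℕ) {a b c d : ℝ} (ha : 0 < a) (hab : a < b) (hc : 0 < c)
    (hcd : c < d) :
    ∃ χ : En m → ℝ, ContDiff ℝ (⊤ : ℕ∞) χ ∧ (∀ x ∈ tsupport χ, a ≤ ‖x‖ ∧ ‖x‖ ≤ d) ∧
      (∀ x, b ≤ ‖x‖ → ‖x‖ ≤ c → χ x = 1) ∧ ∀ x, |χ x| ≤ 1 := by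
  let f₁ : ContDiffBump (0 : En m) := ⟨c, d, hc, hcd⟩
  let f₂ : ContDiffBump (0 : En m) := ⟨a, b, ha, hab⟩
  refine ⟨fun x => f₁ x * (1 - f₂ x), f₁.contDiff.mul (contDiff_const.sub f₂.contDiff),
    fun x hx => ?_, fun x h1 h2 => ?_, fun x => ?_⟩
  · have hcl : IsClosed {x : En m | a ≤ ‖x‖ ∧ ‖x‖ ≤ d} :=
      (isClosed_le continuous_const continuous_norm).inter
        (isClosed_le continuous_norm continuous_const)
    refine closure_minimal (fun y hy => ?_) hcl hx
    rw [Function.mem_support] at hy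
    constructor
    · by_contra! h
      refine hy ?_
      rw [f₂.one_of_mem_closedBall (by simpa [f₂] using h.le)]
      simp
    · by_contra! h
      refine hy ?_
      rw [f₁.zero_of_le_dist (by simpa [f₁] using h.le), zero_mul]
  · beta_reduce
    rw [f₁.one_of_mem_closedBall (by simpa [f₁] using h2),
      f₂.zero_of_le_dist (by simpa [f₂] using h1)]
    norm_num
  · have h1 := f₁.nonneg' x
    have h2 := f₁.le_one (x := x)
    have h3 := f₂.nonneg' x
    have h4 := f₂.le_one (x := x)
    rw [abs_of_nonneg (mul_nonneg h1 (by linarith))]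
    exact mul_le_one₀ h2 (by linarith) (by linarith)

/-- Rescaled annular cutoffs with the natural bounds on their derivatives. -/
lemma exists_scaled_cutoff (m : ℕ) {a b c d : ℝ} (ha : 0 < a) (hab : a < b) (hc : 0 < c)
    (hcd : c < d) :
    ∃ K : ℝ, 0 < K ∧ ∀ r : ℝ, 0 < r → ∃ χ : En m → ℝ, ContDiff ℝ (⊤ : ℕ∞) χ ∧
      (∀ x ∈ tsupport χ, a * r ≤ ‖x‖ ∧ ‖x‖ ≤ d * r) ∧
      (∀ x, b * r ≤ ‖x‖ → ‖x‖ ≤ c * r → χ x = 1) ∧ (∀ x, |χ x| ≤ 1) ∧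
      (∀ x, gam χ χ x ≤ K / r ^ 2) ∧ ∀ x, |lap χ x| ≤ K / r ^ 2 := by
  obtain ⟨χ, h1, h2, h3, h4⟩ := exists_annulus_cutoff m ha hab hc hcd
  have hχ2 : ContDiff ℝ 2 χ := mod_cast contDiff_infty.1 h1 2
  have hχ1 : ContDiff ℝ 1 χ := hχ2.of_le (by norm_num)
  have hcs : HasCompactSupport χ :=
    (isCompact_closedBall (0 : En m) d).of_isClosed_subset (isClosed_tsupport χ)
      fun x hx => by simpa using (h2 x hx).2
  have hgs : HasCompactSupport (gam χ χ) :=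
    hcs.of_isClosed_subset (isClosed_tsupport _) (closure_minimal
      (fun _ hx => by_contra fun h => hx (gam_eq_zero_of_notMem h)) (isClosed_tsupport χ))
  obtain ⟨K₁, hK₁⟩ := (continuous_gam hχ1 hχ1).bounded_above_of_compact_support hgs
  obtain ⟨K₂, hK₂⟩ := (continuous_lap hχ2).bounded_above_of_compact_support
    (hasCompactSupport_lap hcs)
  have hK₁0 : 0 ≤ K₁ := (norm_nonneg _).trans (hK₁ 0)
  have hK₂0 : 0 ≤ K₂ := (norm_nonneg _).trans (hK₂ 0)
  refine ⟨K₁ + K₂ + 1, by positivity, fun r hr => ⟨fun x => χ (r⁻¹ • x),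
    h1.comp (contDiff_const_smul _), fun x hx => ?_, fun x hx1 hx2 => ?_, fun x => h4 _,
    fun x => ?_, fun x => ?_⟩⟩
  · have := h2 (r⁻¹ • x) (tsupport_comp_subset_preimage χ (continuous_const_smul r⁻¹) hx)
    rw [norm_smul, norm_inv, Real.norm_of_nonneg hr.le, inv_mul_eq_div, le_div_iff₀ hr,
      div_le_iff₀ hr] at this
    exact this
  · refine h3 _ ?_ ?_ <;>
      rw [norm_smul, norm_inv, Real.norm_of_nonneg hr.le, inv_mul_eq_div]
    · rwa [le_div_iff₀ hr]
    · rwa [div_le_iff₀ hr]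
  · rw [gam_comp_smul, inv_pow, inv_mul_eq_div]
    gcongr
    linarith [(le_abs_self _).trans (hK₁ (r⁻¹ • x))]
  · rw [lap_comp_smul hχ2, inv_pow, inv_mul_eq_div, abs_div, abs_of_pos (pow_pos hr 2)]
    gcongr
    linarith [hK₂ (r⁻¹ • x), Real.norm_eq_abs (lap χ (r⁻¹ • x))]

end Cutoff

section Stability

open scoped SchwartzMap

variable {m : ℕ}

lemma integral_linearCombination_three {X : Type*} [MeasurableSpace X] {μ : Measure X}
    {f g h : X → ℝ} (hf : Integrable f μ) (hg : Integrable g μ) (hh : Integrable h μ) (p q s : ℝ) :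
    ∫ x, (p * f x + q * g x + s * h x) ∂μ =
      p * (∫ x, f x ∂μ) + q * (∫ x, g x ∂μ) + s * ∫ x, h x ∂μ := by
  have h1 : Integrable (fun x => p * f x + q * g x) μ := (hf.const_mul p).add (hg.const_mul q)
  rw [integral_add h1 (hh.const_mul s), integral_add (hf.const_mul p) (hg.const_mul q),
    integral_const_mul, integral_const_mul, integral_const_mul]

lemma sq_lap_cutoff_mul_le {a k z g p l D : ℝ} (ha : 1 < a) (hk : 0 < k) (hz : |z| ≤ 1)
    {s : ℝ} (hs : 0 ≤ s) (hg : g ^ 2 ≤ k * s) (hl : |l| ≤ k) :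
    (z * D + 2 * g + p * l) ^ 2 ≤ a ^ 2 * D ^ 2 +
      2 * a * (8 * a ^ 2 / (a ^ 2 - 1) * k) * s + (8 * a ^ 2 / (a ^ 2 - 1) * k) ^ 2 * p ^ 2 := by
  have hε : 0 < a ^ 2 - 1 := by nlinarith
  have hq : 1 ≤ a ^ 2 / (a ^ 2 - 1) := by rw [one_le_div hε]; linarith
  set t := a ^ 2 / (a ^ 2 - 1) with ht
  have h8 : 8 * a ^ 2 / (a ^ 2 - 1) = 8 * t := by rw [ht]; ring
  have hεt : (a ^ 2 - 1) * t = a ^ 2 := by rw [ht]; field_simp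
  rw [h8]
  have hz2 : z ^ 2 ≤ 1 := by rw [← sq_abs]; exact pow_le_one₀ (abs_nonneg _) hz
  have hl2 : l ^ 2 ≤ k ^ 2 := by rw [← sq_abs]; exact pow_le_pow_left₀ (abs_nonneg _) hl 2
  have h1 : ∀ x y : ℝ, (x + y) ^ 2 ≤ a ^ 2 * x ^ 2 + t * y ^ 2 := fun x y => by
    have hy : t * ((a ^ 2 - 1) * x ^ 2 - 2 * x * y + (t - 1) * y ^ 2) =
        (a * x) ^ 2 - 2 * t * x * y + t * (t - 1) * y ^ 2 := by
      linear_combination x ^ 2 * hεt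
    have h2 : 0 ≤ (a ^ 2 - 1) * x ^ 2 - 2 * x * y + (t - 1) * y ^ 2 := by
      have h3 : (a ^ 2 - 1) * (t - 1) = 1 := by linear_combination hεt
      have h4 : (a ^ 2 - 1) * ((a ^ 2 - 1) * x ^ 2 - 2 * x * y + (t - 1) * y ^ 2) =
          ((a ^ 2 - 1) * x - y) ^ 2 := by linear_combination y ^ 2 * h3
      exact nonneg_of_mul_nonneg_right (h4 ▸ sq_nonneg _) hε
    linarith
  have h2 : (2 * g + p * l) ^ 2 ≤ 8 * (k * s) + 2 * (p ^ 2 * k ^ 2) := by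
    have := mul_le_mul_of_nonneg_left hl2 (sq_nonneg p)
    nlinarith [sq_nonneg (2 * g - p * l)]
  have h3 : (z * D) ^ 2 ≤ D ^ 2 := by
    rw [mul_pow]; exact mul_le_of_le_one_left (sq_nonneg _) hz2
  have h4 : t * (8 * (k * s)) ≤ 2 * a * (8 * t * k) * s := by
    have : 0 ≤ t * k * s := by positivity
    nlinarith
  have h5 : t * (2 * (p ^ 2 * k ^ 2)) ≤ (8 * t * k) ^ 2 * p ^ 2 := by
    have : 0 ≤ t * (p ^ 2 * k ^ 2) := by positivity
    nlinarith
  calc (z * D + 2 * g + p * l) ^ 2 = (z * D + (2 * g + p * l)) ^ 2 := by ring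
    _ ≤ a ^ 2 * (z * D) ^ 2 + t * (2 * g + p * l) ^ 2 := h1 _ _
    _ ≤ a ^ 2 * D ^ 2 + t * (8 * (k * s) + 2 * (p ^ 2 * k ^ 2)) := by gcongr
    _ ≤ _ := by linarith

/-- Fourth-order stability, localized and interpolated down to a second-order inequality. -/
lemma Stable4OutsideBall.integral_exp_half_mul_sq_le {u : En m → ℝ} {R : ℝ}
    (hstable : Stable4OutsideBall m u R) (hu : Continuous u) {ζ : En m → ℝ}
    (hζ : TestOn m (closedBall (0 : En m) R)ᶜ ζ) (hζ1 : ∀ x, |ζ x| ≤ 1) {k : ℝ} (hk : 0 < k)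
    (hgam : ∀ x, gam ζ ζ x ≤ k) (hlap : ∀ x, |lap ζ x| ≤ k) {a : ℝ} (ha : 1 < a)
    {ψ : En m → ℝ} (hψ : ContDiff ℝ 2 ψ) (hψc : HasCompactSupport ψ) :
    ∫ x, ζ x * Real.exp (u x / 2) * ψ x ^ 2 ≤
      a * (∫ x, gam ψ ψ x) + 8 * a ^ 2 / (a ^ 2 - 1) * k * ∫ x, ψ x ^ 2 := by
  have hζ2 : ContDiff ℝ 2 ζ := mod_cast contDiff_infty.1 hζ.1 2
  have hW : Continuous fun x => ζ x * Real.exp (u x / 2) :=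
    hζ2.continuous.mul (by fun_prop)
  obtain ⟨M, hM⟩ := hW.bounded_above_of_compact_support hζ.2.1.mul_right
  have hc : 0 < 8 * a ^ 2 / (a ^ 2 - 1) * k :=
    mul_pos (div_pos (by positivity) (by nlinarith)) hk
  set c := 8 * a ^ 2 / (a ^ 2 - 1) * k with hcdef
  refine integral_mul_sq_le_of_resolvent hW (fun x => hM x) (by linarith) hc (fun φ => ?_) hψ hψc
  have hφ2 : ContDiff ℝ 2 φ := φ.smooth 2
  have htest : TestOn m (closedBall (0 : En m) R)ᶜ fun x => ζ x * φ x :=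
    ⟨hζ.1.mul (φ.smooth ⊤), hζ.2.1.mul_right,
      (tsupport_mul_subset_left (f := ζ) (g := φ)).trans hζ.2.2⟩
  have hL : Integrable fun x => lap φ x ^ 2 := by
    simp only [schwartz_lap_eq, sq]; exact schwartz_integrable_mul _ _
  have hG : Integrable (gam φ φ) := schwartz_integrable_gam φ φ
  have hF : Integrable fun x => φ x ^ 2 := by
    simp only [sq]; exact schwartz_integrable_mul _ _
  have hrhs : ∫ x, (-a * lap φ x + c * φ x) ^ 2 =
      ∫ x, (a ^ 2 * lap φ x ^ 2 + 2 * a * c * gam φ φ x + c ^ 2 * φ x ^ 2) := by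
    have hFL : Integrable fun x => φ x * lap φ x := by
      rw [schwartz_lap_eq]; exact schwartz_integrable_mul _ _
    have h1 : ∀ x, (-a * lap φ x + c * φ x) ^ 2 =
        a ^ 2 * lap φ x ^ 2 + -(2 * a * c) * (φ x * lap φ x) + c ^ 2 * φ x ^ 2 := fun x => by ring
    simp only [h1]
    rw [integral_linearCombination_three hL hFL hF, integral_linearCombination_three hL hG hF,
      schwartz_integral_mul_lap]
    ring
  have hlhs : ∫ x, (ζ x * Real.exp (u x / 2) * φ x) ^ 2 =
      ∫ x, Real.exp (u x) * (ζ x * φ x) ^ 2 := by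
    refine integral_congr_ae (ae_of_all _ fun x => ?_)
    have : Real.exp (u x) = Real.exp (u x / 2) ^ 2 := by
      rw [← Real.exp_nat_mul]; congr 1; push_cast; ring
    simp only [this]
    ring
  rw [hlhs, hrhs]
  refine (hstable _ htest).trans (integral_mono_of_nonneg (ae_of_all _ fun _ => sq_nonneg _)
    (((hL.const_mul _).add (hG.const_mul _)).add (hF.const_mul _)) (ae_of_all _ fun x => ?_))
  simp only [lap_mul hζ2 hφ2]
  refine sq_lap_cutoff_mul_le ha hk (hζ1 x) (gam_self_nonneg _ _) ?_ (hlap x)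
  exact (sq_gam_le ζ φ x).trans (mul_le_mul_of_nonneg_right (hgam x) (gam_self_nonneg _ _))

end Stability

section Sobolev

variable {m : ℕ}

lemma sq_norm_fderiv_le_gam (f : En m → ℝ) (x : En m) : ‖fderiv ℝ f x‖ ^ 2 ≤ gam f f x := by
  have h0 := gam_self_nonneg f x
  refine (Real.le_sqrt (norm_nonneg _) h0).1 (ContinuousLinearMap.opNorm_le_bound _
    (Real.sqrt_nonneg _) fun v => ?_)
  have hv : v = ∑ i, v i • (EuclideanSpace.single i (1 : ℝ) : En m) := by
    simpa using ((EuclideanSpace.basisFun (Fin m) ℝ).sum_repr v).symm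
  have hfv : fderiv ℝ f x v = ∑ i, v i * pd i f x := by
    conv_lhs => rw [hv]
    simp [pd]
  rw [hfv, Real.norm_eq_abs, EuclideanSpace.norm_eq, ← Real.sqrt_mul h0]
  refine Real.le_sqrt_of_sq_le ?_
  rw [sq_abs, mul_comm]
  have := Finset.sum_mul_sq_le_sq_mul_sq Finset.univ (fun i => v i) (fun i => pd i f x)
  simpa [gam, sq] using this

/-- The Sobolev inequality `‖w‖_{2m/(m-2)} ≤ C ‖∇w‖_2` in integral form. -/
lemma exists_sobolev (hm : 2 < m) :
    ∃ K : ℝ, 0 ≤ K ∧ ∀ w : En m → ℝ, ContDiff ℝ 1 w → HasCompactSupport w →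
      ∫ x, |w x| ^ (2 * m / ((m : ℝ) - 2)) ≤ K * (∫ x, gam w w x) ^ (m / ((m : ℝ) - 2)) := by
  have hm' : (2 : ℝ) < m := by exact_mod_cast hm
  set p' : ℝ := 2 * m / ((m : ℝ) - 2) with hp'
  have hp'0 : 0 < p' := div_pos (by linarith) (by linarith)
  have hhalf : p' / 2 = m / ((m : ℝ) - 2) := by rw [hp']; ring
  set K₀ : ℝ := (SNormLESNormFDerivOfEqConst ℝ (volume : Measure (En m)) 2 : ℝ) with hK₀
  have hK₀0 : 0 ≤ K₀ := NNReal.coe_nonneg _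
  refine ⟨K₀ ^ p', by positivity, fun w hw hc => ?_⟩
  have hfc : Continuous (fderiv ℝ w) := hw.continuous_fderiv (by norm_num)
  have hfs : HasCompactSupport (fderiv ℝ w) := hc.fderiv ℝ
  obtain ⟨P, hP⟩ : ∃ P : NNReal, (P : ℝ) = p' := ⟨⟨p', hp'0.le⟩, rfl⟩
  have hS := eLpNorm_le_eLpNorm_fderiv_of_eq (volume : Measure (En m)) hw hc (p := 2)
    (p' := P) (by norm_num) (by simp; omega) (by
      simp only [finrank_euclideanSpace, Fintype.card_fin, hP, hp']
      push_cast
      have : (m : ℝ) - 2 ≠ 0 := by linarith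
      field_simp)
  have e1 : eLpNorm w (P : ENNReal) volume = ENNReal.ofReal ((∫ x, |w x| ^ p') ^ p'⁻¹) := by
    have hP0 : P ≠ 0 := by rintro rfl; exact hp'0.ne hP
    rw [MemLp.eLpNorm_eq_integral_rpow_norm (by exact_mod_cast hP0)
      ENNReal.coe_ne_top (hw.continuous.memLp_of_hasCompactSupport hc)]
    simp [hP]
  have e2 : eLpNorm (fderiv ℝ w) ((2 : NNReal) : ENNReal) volume =
      ENNReal.ofReal ((∫ x, ‖fderiv ℝ w x‖ ^ (2 : ℝ)) ^ (2 : ℝ)⁻¹) := by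
    rw [MemLp.eLpNorm_eq_integral_rpow_norm (by norm_num)
      ENNReal.coe_ne_top (hfc.memLp_of_hasCompactSupport hfs)]
    simp
  have hgi : Integrable (gam w w) :=
    (continuous_gam hw hw).integrable_of_hasCompactSupport
      (hc.of_isClosed_subset (isClosed_tsupport _) (closure_minimal
        (fun _ hx => by_contra fun h => hx (gam_eq_zero_of_notMem h)) (isClosed_tsupport w)))
  have hI : (∫ x, ‖fderiv ℝ w x‖ ^ (2 : ℝ)) ≤ ∫ x, gam w w x := by
    refine integral_mono_of_nonneg (ae_of_all _ fun _ => by positivity) hgi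
      (ae_of_all _ fun x => ?_)
    simpa only [Real.rpow_two] using sq_norm_fderiv_le_gam w x
  have hE0 : 0 ≤ ∫ x, gam w w x := integral_nonneg fun x => gam_self_nonneg w x
  have hD0 : 0 ≤ ∫ x, ‖fderiv ℝ w x‖ ^ (2 : ℝ) := integral_nonneg fun x => by positivity
  have hA0 : 0 ≤ ∫ x, |w x| ^ p' := integral_nonneg fun x => by positivity
  rw [e1, e2, ← ENNReal.ofReal_coe_nnreal, ← ENNReal.ofReal_mul (NNReal.coe_nonneg _),
    ENNReal.ofReal_le_ofReal_iff (by positivity)] at hS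
  have h := Real.rpow_le_rpow (by positivity) hS hp'0.le
  rw [← Real.rpow_mul hA0, inv_mul_cancel₀ hp'0.ne', Real.rpow_one] at h
  refine h.trans ?_
  rw [Real.mul_rpow (NNReal.coe_nonneg _) (by positivity), ← Real.rpow_mul hD0, ← hhalf,
    show (2 : ℝ)⁻¹ * p' = p' / 2 by ring]
  exact mul_le_mul_of_nonneg_left (Real.rpow_le_rpow hD0 hI (by positivity)) (by positivity)

end Sobolev

lemma cubic_neg_of_between_roots {αs αst α : ℝ} (hr1 : αst ^ 3 - 8 * αst + 4 = 0)
    (hr2 : αs ^ 3 - 8 * αs + 4 = 0) (hlt : αs < αst)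
    (hsecond : ∀ x : ℝ, x ^ 3 - 8 * x + 4 = 0 → x ≠ αst → x ≤ αs)
    (hα1 : αs < α) (hα2 : α < αst) : 1 / 2 < α ∧ α ^ 3 + 4 < 8 * α := by
  have hcont : Continuous fun x : ℝ => x ^ 3 - 8 * x + 4 := by fun_prop
  obtain ⟨y, hy, hy0⟩ : ∃ y ∈ Icc (0 : ℝ) 1, y ^ 3 - 8 * y + 4 = 0 :=
    intermediate_value_Icc' zero_le_one hcont.continuousOn (by norm_num)
  obtain ⟨z, hz, hz0⟩ : ∃ z ∈ Icc (1 : ℝ) 3, z ^ 3 - 8 * z + 4 = 0 :=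
    intermediate_value_Icc (by norm_num) hcont.continuousOn (by norm_num)
  have hz1 : z ≠ 1 := by rintro rfl; norm_num at hz0
  have hyz : y < z := lt_of_le_of_lt hy.2 (lt_of_le_of_ne hz.1 hz1.symm)
  have hpos : 0 ≤ αs := by
    by_cases h : y = αst
    · have := hsecond z hz0 (by rintro rfl; exact hyz.ne h)
      linarith [hz.1]
    · linarith [hsecond y hy0 h, hy.1]
  have hquot : αst ^ 2 + αst * αs + αs ^ 2 = 8 := by
    have : (αst - αs) * (αst ^ 2 + αst * αs + αs ^ 2 - 8) = 0 := by linear_combination hr1 - hr2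
    rcases mul_eq_zero.1 this with h | h <;> linarith
  have hfac : α ^ 3 - 8 * α + 4 = (α - αs) * (α - αst) * (α + αs + αst) := by
    linear_combination (α - αst) * hquot + hr1
  have hneg : α ^ 3 - 8 * α + 4 < 0 := by
    rw [hfac]
    have h1 : 0 < (α - αs) * (αst - α) * (α + αs + αst) := by
      have := sub_pos.2 hα1
      have := sub_pos.2 hα2
      have : 0 < α + αs + αst := by linarith
      positivity
    linarith
  have hα0 : 0 < α := by linarith
  have : 0 < α ^ 3 := by positivity
  constructor <;> linarith

section PowerCalculus

variable {m : ℕ} {u v : En m → ℝ} {α : ℝ}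

lemma exp_mul_lap_exp (hu : ContDiff ℝ 2 u) (s : ℝ) (x : En m) :
    Real.exp (s * u x) * lap (fun y => Real.exp (s * u y)) x =
      -(s * -lap u x * Real.exp (s * u x) ^ 2) +
        1 * gam (fun y => Real.exp (s * u y)) (fun y => Real.exp (s * u y)) x := by
  have hud : Differentiable ℝ u := hu.differentiable (by norm_num)
  have hF : ∀ t : ℝ, HasDerivAt (fun t => Real.exp (s * t)) (s * Real.exp (s * t)) t := fun t => by
    simpa [mul_comm] using ((hasDerivAt_id t).const_mul s).exp
  have hF' : HasDerivAt (fun t => s * Real.exp (s * t)) (s * (s * Real.exp (s * u x))) (u x) :=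
    (hF (u x)).const_mul s
  rw [lap_comp hu (fun y => hF (u y)) hF', gam_comp_left (hF (u x)) (hud x),
    gam_comm u fun y => Real.exp (s * u y),
    gam_comp_left (hF (u x)) (hud x)]
  ring

lemma rpow_mul_lap_rpow (hv : ContDiff ℝ 2 v) (hv0 : ∀ x, 0 < v x) (hα : α ≠ 0) (x : En m) :
    v x ^ α * lap (fun y => v y ^ α) x =
      -(α * v x ^ (2 * α - 1) * -lap v x) +
        (α - 1) / α * gam (fun y => v y ^ α) (fun y => v y ^ α) x := by
  have hvd : Differentiable ℝ v := hv.differentiable (by norm_num)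
  have hF : ∀ (s : ℝ) y, HasDerivAt (fun t : ℝ => t ^ s) (s * v y ^ (s - 1)) (v y) := fun s y =>
    Real.hasDerivAt_rpow_const (Or.inl (hv0 y).ne')
  have hF' := (hF (α - 1) x).const_mul α
  rw [lap_comp (F' := fun t => α * t ^ (α - 1)) hv (fun y => hF α y) hF',
    gam_comp_left (hF α x) (hvd x), gam_comm v fun y => v y ^ α,
    gam_comp_left (hF α x) (hvd x)]
  have e1 : v x ^ (2 * α - 1) = v x ^ α * v x ^ (α - 1) := by
    rw [← Real.rpow_add (hv0 x)]; congr 1; ring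
  have e2 : v x ^ α * v x ^ (α - 1 - 1) = v x ^ (α - 1) * v x ^ (α - 1) := by
    rw [← Real.rpow_add (hv0 x), ← Real.rpow_add (hv0 x)]; congr 1; ring
  rw [e1]
  have : (α - 1) / α * α = α - 1 := by field_simp
  linear_combination (α * (α - 1) * gam v v x) * e2 -
    α * v x ^ (α - 1) * v x ^ (α - 1) * gam v v x * this

end PowerCalculus

section EnergyBound

variable {m : ℕ}

lemma weighted_exp_rpow_le {q β μ α u v : ℝ} (hα : 1 / 2 ≤ α) (hq : 0 < q) (hμ : 0 < μ)
    (hqβ : q * β = μ ^ 2) (hv : 0 < v) :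
    q * (v * Real.exp (α / 2 * u) ^ 2) +
        (μ / q) ^ (-(2 * α)) * (β * (v ^ (2 * α - 1) * Real.exp u)) ≤
      μ * (Real.exp (u / 2) * Real.exp (α / 2 * u) ^ 2 +
        (μ / q) ^ (-(2 * α)) * (Real.exp (u / 2) * (v ^ α) ^ 2)) := by
  have hρ : 0 < Real.exp (u / 2) := Real.exp_pos _
  have h := mul_le_mul_of_nonneg_left
    (weighted_rpow_le (p := 2 * α) (by linarith) hq hμ hqβ hρ hv) hρ.le
  have e1 : Real.exp (α / 2 * u) ^ 2 = Real.exp (u / 2) ^ (2 * α) := by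
    rw [← Real.exp_mul, ← Real.exp_nat_mul]; congr 1; push_cast; ring
  have e2 : Real.exp u = Real.exp (u / 2) * Real.exp (u / 2) := by
    rw [← Real.exp_add, add_halves]
  have e3 : (v ^ α) ^ 2 = v ^ (2 * α) := by
    rw [← Real.rpow_natCast, ← Real.rpow_mul hv.le]; congr 1; push_cast; ring
  have e4 : Real.exp (u / 2) ^ (2 * α) = Real.exp (u / 2) ^ (2 * α - 1) * Real.exp (u / 2) := by
    rw [Real.rpow_sub_one hρ.ne', div_mul_cancel₀ _ hρ.ne']
  rw [e1, e2, e3]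
  rw [e4] at h ⊢
  linarith

lemma absorb_energy {E₁ E₂ N₁ N₂ l θ P k : ℝ} (hl : 0 < l) (hθ : θ < 1) (hP : 0 ≤ P) (hk : 0 ≤ k)
    (hE₁ : 0 ≤ E₁) (hE₂ : 0 ≤ E₂) (hN₁ : 0 ≤ N₁) (hN₂ : 0 ≤ N₂)
    (h : E₁ + l * E₂ ≤ θ * (E₁ + l * E₂) + P * k * (N₁ + l * N₂)) :
    E₁ ≤ P * (1 + l) * (1 + l⁻¹) / (1 - θ) * k * (N₁ + N₂) ∧
      E₂ ≤ P * (1 + l) * (1 + l⁻¹) / (1 - θ) * k * (N₁ + N₂) := by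
  have hθ' : 0 < 1 - θ := by linarith
  have hl' : 0 < l⁻¹ := inv_pos.2 hl
  have hX : E₁ + l * E₂ ≤ P * k * ((1 + l) * (N₁ + N₂)) / (1 - θ) := by
    rw [le_div_iff₀ hθ']
    have h1 : N₁ + l * N₂ ≤ (1 + l) * (N₁ + N₂) := by
      nlinarith [mul_nonneg hl.le hN₁]
    have := mul_le_mul_of_nonneg_left h1 (mul_nonneg hP hk)
    linarith
  have hY : 0 ≤ P * k * ((1 + l) * (N₁ + N₂)) / (1 - θ) := by positivity
  set Y := P * k * ((1 + l) * (N₁ + N₂)) / (1 - θ) with hYdef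
  have hZ : P * (1 + l) * (1 + l⁻¹) / (1 - θ) * k * (N₁ + N₂) = (1 + l⁻¹) * Y := by
    rw [hYdef]; ring
  rw [hZ]
  have h2 : l⁻¹ * (l * E₂) = E₂ := inv_mul_cancel_left₀ hl.ne' _
  have h3 : 0 ≤ l * E₂ := mul_nonneg hl.le hE₂
  constructor
  · nlinarith [mul_nonneg hl'.le hY]
  · have : l⁻¹ * (l * E₂) ≤ l⁻¹ * Y := mul_le_mul_of_nonneg_left (by linarith) hl'.le
    linarith

lemma lap_neg (f : En m → ℝ) (x : En m) : lap (fun y => -f y) x = -lap f x := by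
  simp [lap, fderiv_fun_neg]

lemma integral_gam_exp_mul_le {u η : En m → ℝ} {α k : ℝ} {S : Set (En m)} (hu : ContDiff ℝ 4 u)
    (hη : ContDiff ℝ 2 η) (hS : IsCompact S) (hηS : tsupport η ⊆ S)
    (h1 : ∀ x, |η x| ≤ 1) (hg : ∀ x, gam η η x ≤ k) (hl : ∀ x, |lap η x| ≤ k) :
    ∫ x, gam (fun y => Real.exp (α / 2 * u y) * η y) (fun y => Real.exp (α / 2 * u y) * η y) x ≤
      α / 4 * (∫ x, (-lap u x * Real.exp (α / 2 * u x) ^ 2) * η x ^ 2) +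
        k * ∫ x in S, Real.exp (α / 2 * u x) ^ 2 := by
  have hu2 : ContDiff ℝ 2 u := hu.of_le (by norm_num)
  have huc : Continuous u := hu2.continuous
  have hlc : Continuous (lap u) := continuous_lap hu2
  have h := energy_le (q := fun x => α / 2 * -lap u x * Real.exp (α / 2 * u x) ^ 2) (κ := 1)
    (contDiff_const.mul hu2).exp hη hS hηS (by fun_prop) (exp_mul_lap_exp hu2 (α / 2))
    (by norm_num) h1 hg hl
  simp only [mul_assoc (α / 2)] at h
  rw [integral_const_mul] at h
  refine h.trans_eq ?_
  rw [abs_one, inv_mul_cancel₀ (by norm_num : (1 : ℝ) + 1 ≠ 0), one_mul, ← mul_assoc]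
  norm_num
  left
  ring

lemma integral_gam_rpow_mul_le {u η : En m → ℝ} {α k : ℝ} {S : Set (En m)} (hα : 1 / 2 < α)
    (hu : ContDiff ℝ 4 u) (heq : ∀ x, lap (lap u) x = Real.exp (u x)) (hv : ∀ x, 0 < -lap u x)
    (hη : ContDiff ℝ 2 η) (hS : IsCompact S) (hηS : tsupport η ⊆ S)
    (h1 : ∀ x, |η x| ≤ 1) (hg : ∀ x, gam η η x ≤ k) (hl : ∀ x, |lap η x| ≤ k) :
    ∫ x, gam (fun y => (-lap u y) ^ α * η y) (fun y => (-lap u y) ^ α * η y) x ≤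
      α ^ 2 / (2 * α - 1) * (∫ x, ((-lap u x) ^ (2 * α - 1) * Real.exp (u x)) * η x ^ 2) +
        α / (2 * α - 1) * (1 + |(α - 1) / α|) * k * ∫ x in S, ((-lap u x) ^ α) ^ 2 := by
  have hα0 : 0 < α := by linarith
  have h2α : 0 < 2 * α - 1 := by linarith
  have hκ : (1 + (α - 1) / α)⁻¹ = α / (2 * α - 1) := by
    rw [← inv_div]; field_simp; ring
  have hlap2 : ContDiff ℝ 2 (lap u) := contDiff_lap (k := 2) hu
  have hv2 : ContDiff ℝ 2 fun x => -lap u x := hlap2.neg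
  have hvc : Continuous fun x => (-lap u x) ^ (2 * α - 1) :=
    hv2.continuous.rpow_const fun x => Or.inl (hv x).ne'
  have huc : Continuous u := hu.continuous
  have hlapv : ∀ x, -lap (fun y => -lap u y) x = Real.exp (u x) := fun x => by
    rw [lap_neg, neg_neg, heq]
  have h := energy_le (q := fun x => α * ((-lap u x) ^ (2 * α - 1) * Real.exp (u x)))
    (κ := (α - 1) / α) (hv2.rpow_const_of_ne fun x => (hv x).ne') hη hS hηS (by fun_prop)
    (fun x => by rw [rpow_mul_lap_rpow hv2 hv hα0.ne' x, hlapv, mul_assoc])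
    (inv_pos.1 (hκ ▸ div_pos hα0 h2α)) h1 hg hl
  simp only [mul_assoc α] at h
  rw [integral_const_mul, hκ] at h
  refine h.trans_eq ?_
  rw [← mul_assoc (α / (2 * α - 1)) α, div_mul_eq_mul_div, ← sq]

lemma Stable4OutsideBall.integral_exp_half_mul_sq_mul_sq_le {u : En m → ℝ} {R : ℝ}
    (hstable : Stable4OutsideBall m u R) (hu : Continuous u) {ζ η w : En m → ℝ} {S : Set (En m)}
    (hζ : TestOn m (closedBall (0 : En m) R)ᶜ ζ) (hζ1 : ∀ x, |ζ x| ≤ 1) {k : ℝ} (hk : 0 < k)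
    (hgam : ∀ x, gam ζ ζ x ≤ k) (hlap : ∀ x, |lap ζ x| ≤ k) {a : ℝ} (ha : 1 < a)
    (hη : ContDiff ℝ 2 η) (hS : IsCompact S) (hηS : tsupport η ⊆ S) (hζS : ∀ x ∈ S, ζ x = 1)
    (hη1 : ∀ x, |η x| ≤ 1) (hw : ContDiff ℝ 2 w) :
    ∫ x, (Real.exp (u x / 2) * w x ^ 2) * η x ^ 2 ≤
      a * (∫ x, gam (fun y => w y * η y) (fun y => w y * η y) x) +
        8 * a ^ 2 / (a ^ 2 - 1) * k * ∫ x in S, w x ^ 2 := by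
  have hη0 : ∀ x, x ∉ S → η x = 0 := fun x hx => image_eq_zero_of_notMem_tsupport
    fun h => hx (hηS h)
  have hc : 0 < 8 * a ^ 2 / (a ^ 2 - 1) := div_pos (by positivity) (by nlinarith)
  have h := hstable.integral_exp_half_mul_sq_le hu hζ hζ1 hk hgam hlap ha (hw.mul hη)
    (HasCompactSupport.mul_left (hS.of_isClosed_subset (isClosed_tsupport η) hηS))
  have h1 : ∫ x, (w x * η x) ^ 2 ≤ ∫ x in S, w x ^ 2 := by
    have := integral_sq_mul_le (w := w) (b := fun x => η x ^ 2) hS hw.continuous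
      (hη.continuous.pow 2) (fun x hx => by simp [hη0 x hx])
      (fun x => by rw [← sq_abs]; exact pow_le_one₀ (abs_nonneg _) (hη1 x))
    simpa only [one_mul, ← mul_pow] using this
  have h2 : ∫ x, (Real.exp (u x / 2) * w x ^ 2) * η x ^ 2 =
      ∫ x, ζ x * Real.exp (u x / 2) * (w x * η x) ^ 2 := by
    refine integral_congr_ae (ae_of_all _ fun x => ?_)
    by_cases hx : x ∈ S
    · simp only [hζS x hx]; ring
    · simp [hη0 x hx]
  rw [h2]
  exact h.trans (by gcongr)

lemma integral_weighted_exp_rpow_le {q β μ α : ℝ} {u η : En m → ℝ} (hα : 1 / 2 ≤ α) (hq : 0 < q)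
    (hμ : 0 < μ) (hqβ : q * β = μ ^ 2) (hu : ContDiff ℝ 2 u) (hv : ∀ x, 0 < -lap u x)
    (hη : Continuous η) (hηc : HasCompactSupport η) :
    q * (∫ x, (-lap u x * Real.exp (α / 2 * u x) ^ 2) * η x ^ 2) +
        (μ / q) ^ (-(2 * α)) *
          (β * ∫ x, ((-lap u x) ^ (2 * α - 1) * Real.exp (u x)) * η x ^ 2) ≤
      μ * ((∫ x, (Real.exp (u x / 2) * Real.exp (α / 2 * u x) ^ 2) * η x ^ 2) +
        (μ / q) ^ (-(2 * α)) * ∫ x, (Real.exp (u x / 2) * ((-lap u x) ^ α) ^ 2) * η x ^ 2) := by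
  have huc : Continuous u := hu.continuous
  have hlc : Continuous (lap u) := continuous_lap hu
  have hvc : ∀ s : ℝ, Continuous fun x => (-lap u x) ^ s := fun s =>
    hlc.neg.rpow_const fun x => Or.inl (hv x).ne'
  have hvα := hvc α
  have hvα' := hvc (2 * α - 1)
  have hint : ∀ f : En m → ℝ, Continuous f → Integrable fun x => f x * η x ^ 2 := fun f hf =>
    (hf.mul (hη.pow 2)).integrable_of_hasCompactSupport
      (HasCompactSupport.intro hηc fun x hx => by simp [image_eq_zero_of_notMem_tsupport hx])
  have i₁ := hint (fun x => -lap u x * Real.exp (α / 2 * u x) ^ 2) (by fun_prop)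
  have i₂ := hint (fun x => (-lap u x) ^ (2 * α - 1) * Real.exp (u x)) (by fun_prop)
  have i₃ := hint (fun x => Real.exp (u x / 2) * Real.exp (α / 2 * u x) ^ 2) (by fun_prop)
  have i₄ := hint (fun x => Real.exp (u x / 2) * ((-lap u x) ^ α) ^ 2) (by fun_prop)
  generalize hl : (μ / q) ^ (-(2 * α)) = l
  rw [← integral_const_mul, ← integral_const_mul, ← integral_const_mul, ← integral_const_mul,
    ← integral_add (i₁.const_mul _) ((i₂.const_mul _).const_mul _),
    ← integral_add i₃ (i₄.const_mul _), ← integral_const_mul]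
  refine integral_mono ((i₁.const_mul _).add ((i₂.const_mul _).const_mul _))
    ((i₃.add (i₄.const_mul _)).const_mul _) fun x => ?_
  have := mul_le_mul_of_nonneg_right
    (weighted_exp_rpow_le (u := u x) hα hq hμ hqβ (hv x)) (sq_nonneg (η x))
  rw [hl] at this
  dsimp only
  linarith

/-- The Caccioppoli-type estimate for `e^{αu/2}` and `(-Δu)^α`. -/
lemma exists_energy_bound {u : En m → ℝ} {R α : ℝ} (hα : 1 / 2 < α) (hα3 : α ^ 3 + 4 < 8 * α)
    (hu : ContDiff ℝ 4 u) (heq : ∀ x, lap (lap u) x = Real.exp (u x))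
    (hv : ∀ x, 0 < -lap u x) (hstable : Stable4OutsideBall m u R) :
    ∃ L : ℝ, 0 ≤ L ∧ ∀ (η ζ : En m → ℝ) (S : Set (En m)) (k : ℝ), 0 < k → ContDiff ℝ 2 η →
      TestOn m (closedBall (0 : En m) R)ᶜ ζ → IsCompact S → tsupport η ⊆ S →
      (∀ x ∈ S, ζ x = 1) → (∀ x, |η x| ≤ 1) → (∀ x, gam η η x ≤ k) → (∀ x, |lap η x| ≤ k) →
      (∀ x, |ζ x| ≤ 1) → (∀ x, gam ζ ζ x ≤ k) → (∀ x, |lap ζ x| ≤ k) →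
      let N := (∫ x in S, Real.exp (α / 2 * u x) ^ 2) + ∫ x in S, ((-lap u x) ^ α) ^ 2
      (∫ x, gam (fun y => Real.exp (α / 2 * u y) * η y)
        (fun y => Real.exp (α / 2 * u y) * η y) x ≤ L * k * N) ∧
      ∫ x, gam (fun y => (-lap u y) ^ α * η y) (fun y => (-lap u y) ^ α * η y) x ≤ L * k * N := by
  have hα0 : 0 < α := by linarith
  have h2α : 0 < 2 * α - 1 := by linarith
  have hu2 : ContDiff ℝ 2 u := hu.of_le (by norm_num)
  have hlap2 : ContDiff ℝ 2 (lap u) := contDiff_lap (k := 2) hu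
  have hw₁ : ContDiff ℝ 2 fun x => Real.exp (α / 2 * u x) := (contDiff_const.mul hu2).exp
  have hw₂ : ContDiff ℝ 2 fun x => (-lap u x) ^ α :=
    hlap2.neg.rpow_const_of_ne fun x => (hv x).ne'
  obtain ⟨q, hq⟩ : ∃ q, q = α / 4 := ⟨_, rfl⟩
  obtain ⟨β, hβ⟩ : ∃ β, β = α ^ 2 / (2 * α - 1) := ⟨_, rfl⟩
  have hq0 : 0 < q := by rw [hq]; positivity
  have hβ0 : 0 < β := by rw [hβ]; positivity
  obtain ⟨μ, hμ⟩ : ∃ μ, μ = √(q * β) := ⟨_, rfl⟩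
  have hμ0 : 0 < μ := hμ ▸ Real.sqrt_pos.2 (mul_pos hq0 hβ0)
  have hμ2 : q * β = μ ^ 2 := hμ ▸ (Real.sq_sqrt (mul_pos hq0 hβ0).le).symm
  have hμ1 : μ < 1 := by
    rw [hμ, Real.sqrt_lt' one_pos, hq, hβ, one_pow, div_mul_div_comm, div_lt_one (by positivity)]
    linarith
  obtain ⟨l, hl⟩ : ∃ l, l = (μ / q) ^ (-(2 * α)) := ⟨_, rfl⟩
  have hl0 : 0 < l := hl ▸ Real.rpow_pos_of_pos (div_pos hμ0 hq0) _
  obtain ⟨a, ha⟩ : ∃ a, a = (1 + μ⁻¹) / 2 := ⟨_, rfl⟩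
  have hμinv : 1 < μ⁻¹ := (one_lt_inv₀ hμ0).2 hμ1
  have ha1 : 1 < a := by rw [ha]; linarith
  have hμa : μ * a < 1 := by
    rw [ha]
    have : μ * μ⁻¹ = 1 := mul_inv_cancel₀ hμ0.ne'
    linarith
  obtain ⟨c₀, hc₀⟩ : ∃ c₀, c₀ = 8 * a ^ 2 / (a ^ 2 - 1) := ⟨_, rfl⟩
  have hc₀0 : 0 < c₀ := hc₀ ▸ div_pos (by positivity) (by nlinarith)
  obtain ⟨K, hK⟩ : ∃ K, K = α / (2 * α - 1) * (1 + |(α - 1) / α|) := ⟨_, rfl⟩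
  have hK0 : 0 ≤ K := by rw [hK]; positivity
  refine ⟨(μ * c₀ + 1 + K) * (1 + l) * (1 + l⁻¹) / (1 - μ * a),
    div_nonneg (by positivity) (by linarith), fun η ζ S k hk hη hζ hS hηS hζS hη1 hηg hηl hζ1 hζg
      hζl => ?_⟩
  have hE₁ := integral_gam_exp_mul_le (α := α) hu hη hS hηS hη1 hηg hηl
  have hE₂ := integral_gam_rpow_mul_le hα hu heq hv hη hS hηS hη1 hηg hηl
  have hH₁ := hstable.integral_exp_half_mul_sq_mul_sq_le hu2.continuous hζ hζ1 hk hζg hζl ha1 hη hS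
    hηS hζS hη1 hw₁
  have hH₂ := hstable.integral_exp_half_mul_sq_mul_sq_le hu2.continuous hζ hζ1 hk hζg hζl ha1 hη hS
    hηS hζS hη1 hw₂
  have hW := integral_weighted_exp_rpow_le hα.le hq0 hμ0 hμ2 hu2 hv hη.continuous
    (hS.of_isClosed_subset (isClosed_tsupport η) hηS)
  rw [← hq] at hE₁
  rw [← hβ, ← hK] at hE₂
  rw [← hc₀] at hH₁ hH₂
  rw [← hl] at hW
  intro N
  refine absorb_energy hl0 hμa (by positivity) hk.le (integral_nonneg fun x => gam_self_nonneg _ x)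
    (integral_nonneg fun x => gam_self_nonneg _ x) (integral_nonneg fun x => sq_nonneg _)
    (integral_nonneg fun x => sq_nonneg _) ?_
  have hN₁ : 0 ≤ ∫ x in S, Real.exp (α / 2 * u x) ^ 2 := integral_nonneg fun x => sq_nonneg _
  have hN₂ : 0 ≤ ∫ x in S, ((-lap u x) ^ α) ^ 2 := integral_nonneg fun x => sq_nonneg _
  clear_value N
  generalize (∫ x in S, Real.exp (α / 2 * u x) ^ 2) = N₁ at *
  generalize (∫ x in S, ((-lap u x) ^ α) ^ 2) = N₂ at *
  generalize (∫ x, gam _ _ x) = E₁ at hE₁ hH₁ ⊢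
  generalize (∫ x, gam _ _ x) = E₂ at hE₂ hH₂ ⊢
  have hp1 : 0 ≤ K * k * N₁ := by positivity
  have hp2 : 0 ≤ l * k * N₂ := by positivity
  have hE₂' := mul_le_mul_of_nonneg_left hE₂ hl0.le
  have hH₂' := mul_le_mul_of_nonneg_left hH₂ hl0.le
  have hH := mul_le_mul_of_nonneg_left (add_le_add hH₁ hH₂') hμ0.le
  linarith

end EnergyBound

section Iteration

variable {m : ℕ}

lemma setIntegral_wide_annulus_le {f : En m → ℝ} {R C p r : ℝ} (hf : Continuous f)
    (hf0 : ∀ x, 0 ≤ f x) (hR : 0 < R)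
    (hbound : ∀ s, 2 * R ≤ s →
      ∫ x in ball (0 : En m) (2 * s) \ ball (0 : En m) s, f x ≤ C * s ^ p) (hr : 3 * R ≤ r) :
    ∫ x in closedBall (0 : En m) (3 * r) \ ball (0 : En m) (3 / 4 * r), f x ≤
      C * ((2 / 3) ^ p + (4 / 3) ^ p + (8 / 3) ^ p) * r ^ p := by
  have hr0 : 0 < r := by linarith
  have hint : ∀ s, IntegrableOn f (ball (0 : En m) (2 * s) \ ball (0 : En m) s) := fun s =>
    (hf.continuousOn.integrableOn_compact (isCompact_closedBall (0 : En m) (2 * s))).mono_set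
      (sdiff_subset.trans ball_subset_closedBall)
  have hb : ∀ c : ℝ, 2 / 3 ≤ c →
      ∫ x in ball (0 : En m) (2 * (c * r)) \ ball (0 : En m) (c * r), f x ≤ C * c ^ p * r ^ p :=
    fun c hc => by
      rw [mul_assoc, ← Real.mul_rpow (by linarith) hr0.le]
      exact hbound _ (by nlinarith)
  set A : ℝ → Set (En m) := fun c => ball (0 : En m) (2 * (c * r)) \ ball (0 : En m) (c * r)
  have hsub : closedBall (0 : En m) (3 * r) \ ball (0 : En m) (3 / 4 * r) ⊆
      (A (2 / 3) ∪ A (4 / 3)) ∪ A (8 / 3) := fun x hx => by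
    simp only [A, mem_union, Set.mem_sdiff, mem_ball, mem_closedBall, dist_zero_right,
      not_lt] at hx ⊢
    rcases lt_or_ge ‖x‖ (4 / 3 * r) with h | h
    · left; left; constructor <;> linarith
    · rcases lt_or_ge ‖x‖ (8 / 3 * r) with h' | h'
      · left; right; constructor <;> linarith
      · right; constructor <;> linarith
  have hI := ((hint (2 / 3 * r)).union (hint (4 / 3 * r))).union (hint (8 / 3 * r))
  have h0 : ∀ s : Set (En m), 0 ≤ᵐ[volume.restrict s] f := fun s => ae_of_all _ hf0
  have hunion : ∀ s t : Set (En m), IntegrableOn f s → IntegrableOn f t →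
      ∫ x in s ∪ t, f x ≤ (∫ x in s, f x) + ∫ x in t, f x := fun s t hs ht => by
    have hs' : Integrable f (volume.restrict s) := hs
    rw [← integral_add_measure hs' ht]
    exact integral_mono_measure (Measure.restrict_union_le s t) (ae_of_all _ hf0)
      (hs'.add_measure ht)
  have h1 := setIntegral_mono_set hI (h0 _) hsub.eventuallyLE
  have h2 := hunion _ _ ((hint (2 / 3 * r)).union (hint (4 / 3 * r))) (hint (8 / 3 * r))
  have h3 := hunion _ _ (hint (2 / 3 * r)) (hint (4 / 3 * r))
  have h4 := hb (2 / 3) le_rfl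
  have h5 := hb (4 / 3) (by norm_num)
  have h6 := hb (8 / 3) (by norm_num)
  linarith

lemma exists_cutoff_pair (m : ℕ) {R : ℝ} (hR : 0 < R) :
    ∃ K, 0 < K ∧ ∀ r, 3 * R ≤ r → ∃ η ζ : En m → ℝ, ContDiff ℝ 2 η ∧
      TestOn m (closedBall (0 : En m) R)ᶜ ζ ∧
      tsupport η ⊆ closedBall (0 : En m) (3 * r) \ ball (0 : En m) (3 / 4 * r) ∧
      (∀ x ∈ closedBall (0 : En m) (3 * r) \ ball (0 : En m) (3 / 4 * r), ζ x = 1) ∧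
      (∀ x, |η x| ≤ 1) ∧ (∀ x, gam η η x ≤ K / r ^ 2) ∧ (∀ x, |lap η x| ≤ K / r ^ 2) ∧
      (∀ x, |ζ x| ≤ 1) ∧ (∀ x, gam ζ ζ x ≤ K / r ^ 2) ∧ (∀ x, |lap ζ x| ≤ K / r ^ 2) ∧
      ∀ x ∈ ball (0 : En m) (2 * r) \ ball (0 : En m) r, η x = 1 := by
  obtain ⟨K₁, hK₁, h₁⟩ := exists_scaled_cutoff m (a := 3 / 4) (b := 1) (c := 2) (d := 3)
    (by norm_num) (by norm_num) (by norm_num) (by norm_num)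
  obtain ⟨K₂, hK₂, h₂⟩ := exists_scaled_cutoff m (a := 1 / 2) (b := 3 / 4) (c := 3) (d := 4)
    (by norm_num) (by norm_num) (by norm_num) (by norm_num)
  refine ⟨K₁ + K₂, by positivity, fun r hr => ?_⟩
  have hr0 : 0 < r := by linarith
  obtain ⟨η, hη, hηs, hη1, hηb, hηg, hηl⟩ := h₁ r hr0
  obtain ⟨ζ, hζ, hζs, hζ1, hζb, hζg, hζl⟩ := h₂ r hr0
  have e₁ : K₁ / r ^ 2 ≤ (K₁ + K₂) / r ^ 2 := by gcongr; linarith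
  have e₂ : K₂ / r ^ 2 ≤ (K₁ + K₂) / r ^ 2 := by gcongr; linarith
  refine ⟨η, ζ, contDiff_infty.1 hη 2, ⟨hζ, ?_, fun x hx => ?_⟩, fun x hx => ?_, fun x hx => ?_,
    hηb, fun x => (hηg x).trans e₁, fun x => (hηl x).trans e₁, hζb, fun x => (hζg x).trans e₂,
    fun x => (hζl x).trans e₂, fun x hx => ?_⟩
  · exact (isCompact_closedBall (0 : En m) (4 * r)).of_isClosed_subset (isClosed_tsupport ζ)
      fun x hx => mem_closedBall_zero_iff.2 (hζs x hx).2
  · have := (hζs x hx).1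
    simp only [mem_compl_iff, mem_closedBall_zero_iff, not_le]
    linarith
  · have := hηs x hx
    simpa only [Set.mem_sdiff, mem_closedBall_zero_iff, mem_ball_zero_iff, not_lt] using this.symm
  · simp only [Set.mem_sdiff, mem_closedBall_zero_iff, mem_ball_zero_iff, not_lt] at hx
    exact hζ1 x hx.2 hx.1
  · simp only [Set.mem_sdiff, mem_ball_zero_iff, not_lt] at hx
    exact hη1 x (by linarith) hx.1.le

lemma setIntegral_abs_rpow_le_of_eq_one {w η : En m → ℝ} {s : Set (En m)} {p : ℝ} (hp : 0 < p)
    (hw : Continuous w) (hη : Continuous η) (hηc : HasCompactSupport η) (hs : MeasurableSet s)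
    (hη1 : ∀ x ∈ s, η x = 1) :
    ∫ x in s, |w x| ^ p ≤ ∫ x, |w x * η x| ^ p := by
  have hint : Integrable fun x => |w x * η x| ^ p :=
    ((hw.mul hη).abs.rpow_const fun _ => Or.inr hp.le).integrable_of_hasCompactSupport
      (HasCompactSupport.intro hηc fun x hx => by
        simp [image_eq_zero_of_notMem_tsupport hx, hp.ne'])
  rw [setIntegral_congr_fun (g := fun x => |w x * η x| ^ p) hs fun x hx => by simp [hη1 x hx]]
  exact setIntegral_le_integral hint (ae_of_all _ fun x => by positivity)

/-- One step of the Moser iteration for positive `-Δu`. -/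
lemma exists_moser_step (hm : 2 < m) {u : En m → ℝ} {R C α : ℝ} (hα : 1 / 2 < α)
    (hα3 : α ^ 3 + 4 < 8 * α) (hu : ContDiff ℝ 4 u)
    (heq : ∀ x, lap (lap u) x = Real.exp (u x)) (hv : ∀ x, 0 < -lap u x)
    (hR : 0 < R) (hstable : Stable4OutsideBall m u R) (hC : 0 < C)
    (hbound : ∀ r, 2 * R ≤ r → ∫ x in ball (0 : En m) (2 * r) \ ball (0 : En m) r,
      (Real.exp (α / 2 * u x) ^ 2 + ((-lap u x) ^ α) ^ 2) ≤ C * r ^ ((m : ℝ) - 4 * α)) :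
    ∃ C', 0 < C' ∧ ∀ r, 3 * R ≤ r → ∫ x in ball (0 : En m) (2 * r) \ ball (0 : En m) r,
      (|Real.exp (α / 2 * u x)| ^ (2 * m / ((m : ℝ) - 2)) +
        |(-lap u x) ^ α| ^ (2 * m / ((m : ℝ) - 2))) ≤
      C' * (r ^ ((m : ℝ) - 4 * α - 2)) ^ (m / ((m : ℝ) - 2)) := by
  have hm' : (2 : ℝ) < m := mod_cast hm
  have hm2 : 0 < (m : ℝ) - 2 := by linarith
  have hu2 : ContDiff ℝ 2 u := hu.of_le (by norm_num)
  have hlap2 : ContDiff ℝ 2 (lap u) := contDiff_lap (k := 2) hu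
  have hw₁ : ContDiff ℝ 2 fun x => Real.exp (α / 2 * u x) := (contDiff_const.mul hu2).exp
  have hw₂ : ContDiff ℝ 2 fun x => (-lap u x) ^ α :=
    hlap2.neg.rpow_const_of_ne fun x => (hv x).ne'
  have hw₁sq : Continuous fun x => Real.exp (α / 2 * u x) ^ 2 := hw₁.continuous.pow 2
  have hw₂sq : Continuous fun x => ((-lap u x) ^ α) ^ 2 := hw₂.continuous.pow 2
  obtain ⟨K, hK, hcut⟩ := exists_cutoff_pair m hR
  obtain ⟨L, hL, henergy⟩ := exists_energy_bound hα hα3 hu heq hv hstable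
  obtain ⟨M, hM, hsob⟩ := exists_sobolev hm
  obtain ⟨D, hD⟩ : ∃ D, D = C * ((2 / 3) ^ ((m : ℝ) - 4 * α) + (4 / 3) ^ ((m : ℝ) - 4 * α) +
    (8 / 3) ^ ((m : ℝ) - 4 * α)) := ⟨_, rfl⟩
  have hD0 : 0 ≤ D := by rw [hD]; positivity
  refine ⟨2 * M * (L * K * D) ^ (m / ((m : ℝ) - 2)) + 1, by positivity, fun r hr => ?_⟩
  have hr0 : 0 < r := by linarith
  obtain ⟨η, ζ, hη, hζ, hηS, hζS, hη1, hηg, hηl, hζ1, hζg, hζl, hηA⟩ := hcut r hr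
  obtain ⟨S, hSdef⟩ : ∃ S, S = closedBall (0 : En m) (3 * r) \ ball (0 : En m) (3 / 4 * r) :=
    ⟨_, rfl⟩
  have hN := setIntegral_wide_annulus_le
    (f := fun x => Real.exp (α / 2 * u x) ^ 2 + ((-lap u x) ^ α) ^ 2) (hw₁sq.add hw₂sq)
    (fun x => by positivity) hR hbound hr
  rw [← hSdef] at hηS hζS
  have hS : IsCompact S := hSdef ▸ (isCompact_closedBall _ _).diff isOpen_ball
  have hηc : HasCompactSupport η := hS.of_isClosed_subset (isClosed_tsupport η) hηS
  have hE := henergy η ζ S (K / r ^ 2) (by positivity) hη hζ hS hηS hζS hη1 hηg hηl hζ1 hζg hζl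
  simp only [] at hE
  rw [← hSdef, ← hD, integral_add (hw₁sq.continuousOn.integrableOn_compact hS)
    (hw₂sq.continuousOn.integrableOn_compact hS)] at hN
  have hbd : L * (K / r ^ 2) * ((∫ x in S, Real.exp (α / 2 * u x) ^ 2) +
      ∫ x in S, ((-lap u x) ^ α) ^ 2) ≤ L * K * D * r ^ ((m : ℝ) - 4 * α - 2) := by
    refine (mul_le_mul_of_nonneg_left hN (by positivity)).trans_eq ?_
    rw [Real.rpow_sub hr0 _ 2, Real.rpow_two]
    ring
  have hstep : ∀ w : En m → ℝ, ContDiff ℝ 2 w →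
      ∫ x, gam (fun y => w y * η y) (fun y => w y * η y) x ≤ L * K * D * r ^ ((m : ℝ) - 4 * α - 2) →
      ∫ x in ball (0 : En m) (2 * r) \ ball (0 : En m) r, |w x| ^ (2 * m / ((m : ℝ) - 2)) ≤
        M * ((L * K * D) ^ (m / ((m : ℝ) - 2)) *
          (r ^ ((m : ℝ) - 4 * α - 2)) ^ (m / ((m : ℝ) - 2))) := fun w hw hle => by
    rw [← Real.mul_rpow (by positivity) (by positivity)]
    refine (setIntegral_abs_rpow_le_of_eq_one (by positivity) hw.continuous hη.continuous hηc
      (measurableSet_ball.diff measurableSet_ball) hηA).trans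
      ((hsob _ ((hw.mul hη).of_le (by norm_num)) (HasCompactSupport.mul_left hηc)).trans ?_)
    refine mul_le_mul_of_nonneg_left (Real.rpow_le_rpow
      (integral_nonneg fun x => gam_self_nonneg _ x) hle (by positivity)) hM
  have hI : ∀ w : En m → ℝ, Continuous w → IntegrableOn (fun x => |w x| ^ (2 * m / ((m : ℝ) - 2)))
      (ball (0 : En m) (2 * r) \ ball (0 : En m) r) := fun w hw =>
    ((hw.abs.rpow_const fun _ => Or.inr (by positivity)).continuousOn.integrableOn_compact
      (isCompact_closedBall (0 : En m) (2 * r))).mono_set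
      (sdiff_subset.trans ball_subset_closedBall)
  rw [integral_add (hI _ hw₁.continuous) (hI _ hw₂.continuous)]
  have h₁ := hstep _ hw₁ (hE.1.trans hbd)
  have h₂ := hstep _ hw₂ (hE.2.trans hbd)
  have h₃ : 0 ≤ (r ^ ((m : ℝ) - 4 * α - 2)) ^ (m / ((m : ℝ) - 2)) := by positivity
  linarith

end Iteration

/-- (Lemma 6.6 of the paper; one Moser-iteration step.) Let `n > 4`,
let `α♯ < α*` be the two largest real roots of `X³ - 8X + 4`, and let
`α ∈ (α♯, min{n/4, α*})`.  Let `u ∈ C⁴(ℝ^n)` solve `Δ²u = e^u`, be stable outside `B_R` in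
the fourth-order sense, with `Δu → 0` at infinity, and set `v = -Δu`.  If
`∫_{B_{2r}\B_r} (e^{αu} + |v|^{2α}) ≤ C r^{n-4α}` for all `r ≥ 2R`, then
`∫_{B_{2r}\B_r} (e^{(n/(n-2))αu} + |v|^{(2n/(n-2))α}) ≤ C' r^{n-(4n/(n-2))α}` for all
`r ≥ 3R`. -/
theorem moser_iteration_step_fourth_order
    (n : ℕ) (hn : 4 < n)
    (αs αst : ℝ)
    (hr1 : αst ^ 3 - 8 * αst + 4 = 0) (hr2 : αs ^ 3 - 8 * αs + 4 = 0)
    (hlt : αs < αst)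
    (hmax : ∀ x : ℝ, x ^ 3 - 8 * x + 4 = 0 → x ≤ αst)
    (hsecond : ∀ x : ℝ, x ^ 3 - 8 * x + 4 = 0 → x ≠ αst → x ≤ αs)
    (u : En n → ℝ) (hu : ContDiff ℝ (4 : ℕ) u)
    (heq : ∀ x, lap (fun y => lap u y) x = Real.exp (u x))
    (R : ℝ) (hR : 0 < R) (hstable : Stable4OutsideBall n u R)
    (hvanish : Filter.Tendsto (fun x => lap u x) (Filter.cocompact (En n)) (nhds 0))
    (α : ℝ) (hα1 : αs < α) (hα2 : α < min ((n : ℝ) / 4) αst)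
    (C : ℝ) (hC : 0 < C)
    (hbound : ∀ r : ℝ, 2 * R ≤ r →
      ∫ x in Metric.ball (0 : En n) (2 * r) \ Metric.ball (0 : En n) r,
          (Real.exp (α * u x) + |(-(lap u x))| ^ (2 * α)) ≤ C * r ^ ((n : ℝ) - 4 * α)) :
    ∃ C' > (0:ℝ), ∀ r : ℝ, 3 * R ≤ r →
      ∫ x in Metric.ball (0 : En n) (2 * r) \ Metric.ball (0 : En n) r,
          (Real.exp ((n / ((n : ℝ) - 2)) * α * u x) +
            |(-(lap u x))| ^ ((2 * n / ((n : ℝ) - 2)) * α)) ≤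
        C' * r ^ ((n : ℝ) - (4 * n / ((n : ℝ) - 2)) * α) := by
  have hn' : (4 : ℝ) < n := mod_cast hn
  have hn2 : (n : ℝ) - 2 ≠ 0 := by linarith
  obtain ⟨hα, hα3⟩ := cubic_neg_of_between_roots hr1 hr2 hlt hsecond hα1
    (hα2.trans_le (min_le_right _ _))
  have hu4 : ContDiff ℝ 4 u := hu
  have hlap2 : ContDiff ℝ 2 (lap u) := contDiff_lap (k := 2) hu4
  have heq' : ∀ x, lap (lap u) x = Real.exp (u x) := heq
  have hv : ∀ x, 0 < -lap u x := pos_of_lap_neg hlap2.neg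
    (fun x => by rw [lap_neg, heq']; exact neg_neg_of_pos (Real.exp_pos _))
    (by simpa using hvanish.neg)
  obtain ⟨C', hC', h⟩ := exists_moser_step (by omega) hα hα3 hu4 heq' hv hR hstable hC
    fun r hr => by
      refine le_of_eq_of_le (integral_congr_ae (ae_of_all _ fun x => ?_)) (hbound r hr)
      simp only [abs_of_pos (hv x)]
      rw [← Real.rpow_natCast (_ ^ α), ← Real.rpow_mul (hv x).le, ← Real.exp_nat_mul]
      congr 2 <;> push_cast <;> ring
  refine ⟨C', hC', fun r hr => ?_⟩
  have hr0 : 0 < r := by linarith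
  refine le_of_eq_of_le (integral_congr_ae (ae_of_all _ fun x => ?_)) ((h r hr).trans_eq ?_)
  · simp only [abs_of_pos (hv x), abs_of_pos (Real.exp_pos _),
      abs_of_pos (Real.rpow_pos_of_pos (hv x) _)]
    rw [← Real.rpow_mul (hv x).le, ← Real.exp_mul]
    congr 2 <;> ring
  · rw [← Real.rpow_mul hr0.le]
    congr 2
    field_simp
    ring
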